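/- arXiv:2204.05707 — 11 statements merged into one kernel-verified Lean document; each statement's English description precedes it below -/
import Mathlib

section
/- Let Φ : ℝ^n → 2^{ℝ^n} have nonempty, closed and convex values, let f : ℝ^n → ℝ^n be L-Lipschitz continuous and β-strongly monotone, let α > 0, and suppose there exists κ > 0 with ‖P_{Φ(x)}(z) − P_{Φ(y)}(z)‖ ≤ κ‖x − y‖ for all x, y, z ∈ ℝ^n and L² − 2βα + α² ≥ 0. Define h : ℝ^n → ℝ^n by h(x) = x − (1/α)f(x) + (1/α)P_{Φ(x)}(f(x) − αx). Then for all x, y ∈ ℝ^n, ‖h(x) − h(y)‖ ≤ ((√(L² − 2βα + α²) + κ)/α)‖x − y‖. -/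
open scoped RealInnerProductSpace

/-- The residual of a nearest-point projection is nonexpansive: this only uses the variational
inequality of each of the two projected points `p`, `q` tested at the other one. -/
theorem norm_sub_sub_sub_le_of_inner_le {E : Type*} [NormedAddCommGroup E]
    [InnerProductSpace ℝ E] {z w p q : E} (hp : ⟪z - p, q - p⟫ ≤ 0) (hq : ⟪w - q, p - q⟫ ≤ 0) :
    ‖(z - p) - (w - q)‖ ≤ ‖z - w‖ := by
  have hinner : 0 ≤ ⟪(z - p) - (w - q), p - q⟫ := by
    rw [inner_sub_left]
    rw [← neg_sub p q, inner_neg_right] at hp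
    linarith
  have hsq := norm_add_sq_real ((z - p) - (w - q)) (p - q)
  rw [show (z - p) - (w - q) + (p - q) = z - w by abel] at hsq
  refine le_of_sq_le_sq ?_ (norm_nonneg _)
  nlinarith [sq_nonneg ‖p - q‖]

/-- If `a` has norm at most `L * ‖d‖` and `β * ‖d‖ ^ 2 ≤ ⟪a, d⟫`, then `a - α • d` has norm at most
`√(L ^ 2 - 2 * β * α + α ^ 2) * ‖d‖`. -/
theorem norm_sub_smul_le_sqrt_mul {E : Type*} [NormedAddCommGroup E] [InnerProductSpace ℝ E]
    {a d : E} {L β α : ℝ} (ha : ‖a‖ ≤ L * ‖d‖) (had : β * ‖d‖ ^ 2 ≤ ⟪a, d⟫) (hα : 0 ≤ α)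
    (hdisc : 0 ≤ L ^ 2 - 2 * β * α + α ^ 2) :
    ‖a - α • d‖ ≤ Real.sqrt (L ^ 2 - 2 * β * α + α ^ 2) * ‖d‖ := by
  refine le_of_sq_le_sq ?_ (by positivity)
  rw [mul_pow, Real.sq_sqrt hdisc, norm_sub_sq_real, real_inner_smul_right, norm_smul, mul_pow,
    Real.norm_eq_abs, sq_abs]
  have hsq : ‖a‖ ^ 2 ≤ (L * ‖d‖) ^ 2 := pow_le_pow_left₀ (norm_nonneg _) ha 2
  nlinarith [mul_le_mul_of_nonneg_left had hα]

/-- with Φ having nonempty closed convex values, f L-Lipschitz and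
β-strongly monotone, α > 0, κ > 0 with ‖P_{Φ(x)}(z) − P_{Φ(y)}(z)‖ ≤ κ‖x − y‖
and L² − 2βα + α² ≥ 0, the map h(x) = x − (1/α)f(x) + (1/α)P_{Φ(x)}(f(x) − αx)
satisfies ‖h(x) − h(y)‖ ≤ ((√(L² − 2βα + α²) + κ)/α)‖x − y‖. -/
theorem stmt_5 {n : ℕ} (Φ : EuclideanSpace ℝ (Fin n) → Set (EuclideanSpace ℝ (Fin n)))
    (hΦ : ∀ x, (Φ x).Nonempty ∧ IsClosed (Φ x) ∧ Convex ℝ (Φ x))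
    (P : EuclideanSpace ℝ (Fin n) → EuclideanSpace ℝ (Fin n) → EuclideanSpace ℝ (Fin n))
    (hP : ∀ x z, P x z ∈ Φ x ∧ ∀ y ∈ Φ x, ⟪z - P x z, y - P x z⟫ ≤ 0)
    (f : EuclideanSpace ℝ (Fin n) → EuclideanSpace ℝ (Fin n))
    (L β α κ : ℝ)
    (hLip : ∀ x y, ‖f x - f y‖ ≤ L * ‖x - y‖)
    (hβ : 0 < β)
    (hmono : ∀ x y, β * ‖x - y‖ ^ 2 ≤ ⟪f x - f y, x - y⟫)
    (hα : 0 < α) (hκ : 0 < κ)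
    (hPκ : ∀ x y z, ‖P x z - P y z‖ ≤ κ * ‖x - y‖)
    (hdisc : 0 ≤ L ^ 2 - 2 * β * α + α ^ 2)
    (h : EuclideanSpace ℝ (Fin n) → EuclideanSpace ℝ (Fin n))
    (hdef : ∀ x, h x = x - (1 / α) • f x + (1 / α) • P x (f x - α • x))
    (x y : EuclideanSpace ℝ (Fin n)) :
    ‖h x - h y‖ ≤ ((Real.sqrt (L ^ 2 - 2 * β * α + α ^ 2) + κ) / α) * ‖x - y‖ := by
  set u := f x - α • x
  set v := f y - α • y
  have hres : ‖(u - P x u) - (v - P x v)‖ ≤ ‖u - v‖ :=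
    norm_sub_sub_sub_le_of_inner_le ((hP x u).2 _ (hP x v).1) ((hP x v).2 _ (hP x u).1)
  have huv : ‖u - v‖ ≤ Real.sqrt (L ^ 2 - 2 * β * α + α ^ 2) * ‖x - y‖ := by
    rw [show u - v = (f x - f y) - α • (x - y) by simp only [u, v, smul_sub]; abel]
    exact norm_sub_smul_le_sqrt_mul (hLip x y) (hmono x y) hα.le hdisc
  have hh : h x - h y = α⁻¹ • ((P x v - P y v) - ((u - P x u) - (v - P x v))) := by
    rw [hdef, hdef, one_div]
    simp only [u, v, smul_sub, inv_smul_smul₀ hα.ne']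
    abel
  rw [hh, norm_smul, norm_inv, Real.norm_of_nonneg hα.le, div_mul_eq_mul_div, div_eq_inv_mul]
  gcongr
  linarith [norm_sub_le (P x v - P y v) ((u - P x u) - (v - P x v)), hPκ x y v]
end

section
/- Let Φ : ℝ^n → 2^{ℝ^n} have nonempty, closed and convex values, let f : ℝ^n → ℝ^n be L-Lipschitz continuous and β-strongly monotone, and let α > κ > 0 satisfy L² − 2α(β − κ) < κ², where κ satisfies ‖P_{Φ(x)}(z) − P_{Φ(y)}(z)‖ ≤ κ‖x − y‖ for all x, y, z ∈ ℝ^n. Then the inverse quasi-variational inequality problem has a unique solution: there exists exactly one x* ∈ ℝ^n with f(x*) ∈ Φ(x*) and ⟨x*, y − f(x*)⟩ ≥ 0 for all y ∈ Φ(x*). -/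
open scoped RealInnerProductSpace

/-- If `⟪a - b, b⟫ ≥ 0` then `a - b` is no longer than `a`. -/
theorem norm_sub_le_of_inner_sub_nonneg {E : Type*} [NormedAddCommGroup E]
    [InnerProductSpace ℝ E] {a b : E} (h : 0 ≤ ⟪a - b, b⟫) : ‖a - b‖ ≤ ‖a‖ := by
  have e : a = (a - b) + b := by abel
  have h' : ‖a‖ ^ 2 = ‖a - b‖ ^ 2 + 2 * ⟪a - b, b⟫ + ‖b‖ ^ 2 := by
    conv_lhs => rw [e]
    exact norm_add_sq_real _ _
  refine le_of_sq_le_sq ?_ (norm_nonneg _)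
  nlinarith [sq_nonneg ‖b‖]

/-- The residual `z - p` of a nearest-point projection is a nonexpansive function of `z`, where
`p` and `q` are the projections of `z` and `w` onto `K`. -/
theorem norm_residual_sub_residual_le {E : Type*} [NormedAddCommGroup E]
    [InnerProductSpace ℝ E] {K : Set E} {z w p q : E} (hp : p ∈ K) (hq : q ∈ K)
    (hzp : ∀ y ∈ K, ⟪z - p, y - p⟫ ≤ 0) (hwq : ∀ y ∈ K, ⟪w - q, y - q⟫ ≤ 0) :
    ‖(z - p) - (w - q)‖ ≤ ‖z - w‖ := by
  have e : (z - p) - (w - q) = (z - w) - (p - q) := by abel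
  rw [e]
  apply norm_sub_le_of_inner_sub_nonneg
  have h₁ := hzp q hq
  have h₂ := hwq p hp
  rw [← neg_sub p q, inner_neg_right] at h₁
  rw [← e, inner_sub_left]
  linarith

/-- A Lipschitz, strongly monotone map `f` differs from `α • id` by a map with Lipschitz constant
`√(L² - 2αβ + α²)`. -/
theorem norm_sub_smul_sub_le {E : Type*} [NormedAddCommGroup E] [InnerProductSpace ℝ E]
    {f : E → E} {L β α : ℝ} (hα : 0 ≤ α) {x y : E} (hLip : ‖f x - f y‖ ≤ L * ‖x - y‖)
    (hmono : β * ‖x - y‖ ^ 2 ≤ ⟪f x - f y, x - y⟫) :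
    ‖(f x - α • x) - (f y - α • y)‖ ≤ √(L ^ 2 - 2 * α * β + α ^ 2) * ‖x - y‖ := by
  have e : (f x - α • x) - (f y - α • y) = (f x - f y) - α • (x - y) := by
    rw [smul_sub]; abel
  rw [e]
  have hsq : ‖(f x - f y) - α • (x - y)‖ ^ 2 ≤ (L ^ 2 - 2 * α * β + α ^ 2) * ‖x - y‖ ^ 2 := by
    rw [norm_sub_sq_real, inner_smul_right, norm_smul, mul_pow, Real.norm_eq_abs, sq_abs]
    have h₁ := pow_le_pow_left₀ (norm_nonneg _) hLip 2
    have h₂ := mul_le_mul_of_nonneg_left hmono hα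
    nlinarith
  have h := Real.le_sqrt_of_sq_le hsq
  rwa [Real.sqrt_mul' _ (sq_nonneg _), Real.sqrt_sq (norm_nonneg _)] at h

/-- with Φ having nonempty closed convex values, f L-Lipschitz and
β-strongly monotone, α > κ > 0 with ‖P_{Φ(x)}(z) − P_{Φ(y)}(z)‖ ≤ κ‖x − y‖
for all x, y, z and L² − 2α(β − κ) < κ², the inverse quasi-variational
inequality has a unique solution: there is exactly one x* with f(x*) ∈ Φ(x*)
and ⟨x*, y − f(x*)⟩ ≥ 0 for all y ∈ Φ(x*). -/
theorem stmt_6 {n : ℕ} (Φ : EuclideanSpace ℝ (Fin n) → Set (EuclideanSpace ℝ (Fin n)))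
    (hΦ : ∀ x, (Φ x).Nonempty ∧ IsClosed (Φ x) ∧ Convex ℝ (Φ x))
    (P : EuclideanSpace ℝ (Fin n) → EuclideanSpace ℝ (Fin n) → EuclideanSpace ℝ (Fin n))
    (hP : ∀ x z, P x z ∈ Φ x ∧ ∀ y ∈ Φ x, ⟪z - P x z, y - P x z⟫ ≤ 0)
    (f : EuclideanSpace ℝ (Fin n) → EuclideanSpace ℝ (Fin n))
    (L β α κ : ℝ)
    (hLip : ∀ x y, ‖f x - f y‖ ≤ L * ‖x - y‖)
    (hβ : 0 < β)
    (hmono : ∀ x y, β * ‖x - y‖ ^ 2 ≤ ⟪f x - f y, x - y⟫)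
    (hκ : 0 < κ) (hκα : κ < α)
    (hPκ : ∀ x y z, ‖P x z - P y z‖ ≤ κ * ‖x - y‖)
    (hcond : L ^ 2 - 2 * α * (β - κ) < κ ^ 2) :
    ∃! xs : EuclideanSpace ℝ (Fin n),
      f xs ∈ Φ xs ∧ ∀ y ∈ Φ xs, 0 ≤ ⟪xs, y - f xs⟫ := by
  have hα : 0 < α := hκ.trans hκα
  set θ := √(L ^ 2 - 2 * α * β + α ^ 2) with hθ
  have hθlt : θ < α - κ := by
    rw [hθ, Real.sqrt_lt' (by linarith)]
    nlinarith
  have hθ0 : 0 ≤ θ := Real.sqrt_nonneg _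
  let T : EuclideanSpace ℝ (Fin n) → EuclideanSpace ℝ (Fin n) := fun x =>
    α⁻¹ • (P x (f x - α • x) - (f x - α • x))
  have hT : ∀ x y, ‖T x - T y‖ ≤ α⁻¹ * (θ + κ) * ‖x - y‖ := by
    intro x y
    have e : T x - T y = α⁻¹ • ((P x (f x - α • x) - P y (f x - α • x)) -
        (((f x - α • x) - P y (f x - α • x)) - ((f y - α • y) - P y (f y - α • y)))) := by
      simp only [T]
      rw [← smul_sub]
      congr 1
      abel
    rw [e, norm_smul, Real.norm_of_nonneg (inv_nonneg.2 hα.le), mul_assoc]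
    refine mul_le_mul_of_nonneg_left ?_ (inv_nonneg.2 hα.le)
    have h₁ := norm_residual_sub_residual_le (hP y (f x - α • x)).1 (hP y (f y - α • y)).1
      (hP y (f x - α • x)).2 (hP y (f y - α • y)).2
    have h₂ := norm_sub_smul_sub_le hα.le (hLip x y) (hmono x y)
    have h₃ := hPκ x y (f x - α • x)
    refine (norm_sub_le _ _).trans ?_
    linarith
  have hc0 : 0 ≤ α⁻¹ * (θ + κ) := by positivity
  have hc1 : α⁻¹ * (θ + κ) < 1 := by
    rw [inv_mul_lt_one₀ hα]
    linarith
  have hcontr : ContractingWith ⟨α⁻¹ * (θ + κ), hc0⟩ T :=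
    ⟨hc1, LipschitzWith.of_dist_le_mul fun x y => by
      rw [dist_eq_norm, dist_eq_norm]; exact hT x y⟩
  have hfix : ∀ x, T x = x ↔ P x (f x - α • x) = f x := by
    intro x
    simp only [T]
    rw [inv_smul_eq_iff₀ hα.ne', sub_eq_iff_eq_add, add_sub_cancel]
  have hsol : ∀ x, (f x ∈ Φ x ∧ ∀ y ∈ Φ x, 0 ≤ ⟪x, y - f x⟫) ↔ T x = x := by
    intro x
    obtain ⟨hmem, hvar⟩ := hP x (f x - α • x)
    have hinner : ∀ y, ⟪f x - α • x - f x, y⟫ = -(α * ⟪x, y⟫) := fun y => by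
      rw [sub_sub_cancel_left, inner_neg_left, real_inner_smul_left]
    rw [hfix]
    constructor
    · rintro ⟨hfx, hx⟩
      have h := norm_residual_sub_residual_le hmem hfx hvar fun y hy => by
        rw [hinner]
        exact neg_nonpos.2 (mul_nonneg hα.le (hx y hy))
      rw [sub_self, norm_zero, sub_sub_sub_cancel_left, norm_le_zero_iff, sub_eq_zero] at h
      exact h.symm
    · intro h
      rw [h] at hmem hvar
      refine ⟨hmem, fun y hy => ?_⟩
      have h' := hvar y hy
      rw [hinner] at h'
      exact nonneg_of_mul_nonneg_right (neg_nonpos.1 h') hα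
  refine ⟨ContractingWith.fixedPoint T hcontr, (hsol _).2 hcontr.fixedPoint_isFixedPt,
    fun y hy => hcontr.fixedPoint_unique ((hsol y).1 hy)⟩
end

section
/- Let Φ : ℝ^n → 2^{ℝ^n} have nonempty, closed and convex values, let f : ℝ^n → ℝ^n be L-Lipschitz continuous, let α > 0, let κ > 0 satisfy ‖P_{Φ(x)}(z) − P_{Φ(y)}(z)‖ ≤ κ‖x − y‖ for all x, y, z ∈ ℝ^n, and let λ : [t₀, T] → (0, ∞) be continuous. If x, y : [t₀, T] → ℝ^n are differentiable curves satisfying ẋ(t) = λ(t)(P_{Φ(x(t))}(f(x(t)) − αx(t)) − f(x(t))) and ẏ(t) = λ(t)(P_{Φ(y(t))}(f(y(t)) − αy(t)) − f(y(t))) for all t ∈ [t₀, T], and x(t₀) = y(t₀), then x(t) = y(t) for all t ∈ [t₀, T]. -/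
open scoped RealInnerProductSpace

/-- A map satisfying the variational inequality of the nearest-point projection is nonexpansive. -/
theorem norm_sub_le_of_variational_inequality {E : Type*} [NormedAddCommGroup E]
    [InnerProductSpace ℝ E] {K : Set E} {p : E → E}
    (hp : ∀ z, p z ∈ K ∧ ∀ y ∈ K, ⟪z - p z, y - p z⟫ ≤ 0) (z w : E) :
    ‖p z - p w‖ ≤ ‖z - w‖ := by
  have h₁ := (hp z).2 (p w) (hp w).1
  have h₂ := (hp w).2 (p z) (hp z).1
  have h₃ : ⟪z - p z, p w - p z⟫ = - ⟪z - w, p z - p w⟫ + ‖p z - p w‖ ^ 2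
      - ⟪w - p w, p z - p w⟫ := by
    rw [← real_inner_self_eq_norm_sq]
    simp only [inner_sub_left, inner_sub_right]
    ring
  have h₄ := real_inner_le_norm (z - w) (p z - p w)
  have h₅ : ⟪z - p z, p w - p z⟫ + ⟪w - p w, p z - p w⟫ ≤ 0 := by linarith
  by_contra! h
  nlinarith [norm_nonneg (z - w), norm_nonneg (p z - p w)]

/-- uniqueness of solutions of the neural network
ẋ(t) = λ(t)(P_{Φ(x(t))}(f(x(t)) − αx(t)) − f(x(t))) on [t₀, T]:
two differentiable solutions with the same initial value at t₀ coincide. -/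
theorem stmt_9 {n : ℕ} (Φ : EuclideanSpace ℝ (Fin n) → Set (EuclideanSpace ℝ (Fin n)))
    (hΦ : ∀ x, (Φ x).Nonempty ∧ IsClosed (Φ x) ∧ Convex ℝ (Φ x))
    (P : EuclideanSpace ℝ (Fin n) → EuclideanSpace ℝ (Fin n) → EuclideanSpace ℝ (Fin n))
    (hP : ∀ x z, P x z ∈ Φ x ∧ ∀ y ∈ Φ x, ⟪z - P x z, y - P x z⟫ ≤ 0)
    (f : EuclideanSpace ℝ (Fin n) → EuclideanSpace ℝ (Fin n))
    (L α κ : ℝ)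
    (hLip : ∀ x y, ‖f x - f y‖ ≤ L * ‖x - y‖)
    (hα : 0 < α) (hκ : 0 < κ)
    (hPκ : ∀ x y z, ‖P x z - P y z‖ ≤ κ * ‖x - y‖)
    (t₀ T : ℝ) (hT : t₀ ≤ T)
    (lam : ℝ → ℝ)
    (hlamc : ContinuousOn lam (Set.Icc t₀ T))
    (hlampos : ∀ t ∈ Set.Icc t₀ T, 0 < lam t)
    (x y : ℝ → EuclideanSpace ℝ (Fin n))
    (hx : ∀ t ∈ Set.Icc t₀ T,
      HasDerivWithinAt x (lam t • (P (x t) (f (x t) - α • x t) - f (x t))) (Set.Icc t₀ T) t)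
    (hy : ∀ t ∈ Set.Icc t₀ T,
      HasDerivWithinAt y (lam t • (P (y t) (f (y t) - α • y t) - f (y t))) (Set.Icc t₀ T) t)
    (h0 : x t₀ = y t₀) :
    ∀ t ∈ Set.Icc t₀ T, x t = y t := by
  have hvec (u v : EuclideanSpace ℝ (Fin n)) :
      ‖(P u (f u - α • u) - f u) - (P v (f v - α • v) - f v)‖
        ≤ (κ + 2 * L + α) * ‖u - v‖ := by
    have h₁ := hPκ u v (f u - α • u)
    have h₂ := norm_sub_le_of_variational_inequality (hP v) (f u - α • u) (f v - α • v)
    have h₃ : ‖(f u - α • u) - (f v - α • v)‖ ≤ ‖f u - f v‖ + α * ‖u - v‖ := by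
      calc ‖(f u - α • u) - (f v - α • v)‖ = ‖(f u - f v) - α • (u - v)‖ := by
            congr 1; module
        _ ≤ ‖f u - f v‖ + ‖α • (u - v)‖ := norm_sub_le _ _
        _ = ‖f u - f v‖ + α * ‖u - v‖ := by rw [norm_smul, Real.norm_of_nonneg hα.le]
    calc ‖(P u (f u - α • u) - f u) - (P v (f v - α • v) - f v)‖
        = ‖((P u (f u - α • u) - P v (f u - α • u))
            + (P v (f u - α • u) - P v (f v - α • v))) - (f u - f v)‖ := by
          congr 1; abel
      _ ≤ ‖P u (f u - α • u) - P v (f u - α • u)‖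
            + ‖P v (f u - α • u) - P v (f v - α • v)‖ + ‖f u - f v‖ :=
          (norm_sub_le _ _).trans (by gcongr; exact norm_add_le _ _)
      _ ≤ (κ + 2 * L + α) * ‖u - v‖ := by linarith [hLip u v]
  obtain ⟨M, hM⟩ := isCompact_Icc.exists_bound_of_continuousOn hlamc
  have hderiv : ∀ t ∈ Set.Icc t₀ T, HasDerivWithinAt (fun t => x t - y t)
      (lam t • (P (x t) (f (x t) - α • x t) - f (x t))
        - lam t • (P (y t) (f (y t) - α • y t) - f (y t))) (Set.Icc t₀ T) t :=
    fun t ht => (hx t ht).sub (hy t ht)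
  have hzero := eq_zero_of_abs_deriv_le_mul_abs_self_of_eq_zero_right
    (K := M * (κ + 2 * L + α))
    (fun t ht => (hderiv t ht).continuousWithinAt)
    (fun t ht => (hderiv t (Set.Ico_subset_Icc_self ht)).mono_of_mem_nhdsWithin
      (Icc_mem_nhdsGE_of_mem ht))
    (sub_eq_zero.mpr h0)
    (fun t ht => by
      have hMt := hM t (Set.Ico_subset_Icc_self ht)
      rw [← smul_sub, norm_smul, mul_assoc]
      exact mul_le_mul hMt (hvec (x t) (y t)) (norm_nonneg _) ((norm_nonneg _).trans hMt))
  exact fun t ht => sub_eq_zero.mp (hzero t ht)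
end

section
/- Let Φ : ℝ^n → 2^{ℝ^n} have nonempty, closed and convex values, let f : ℝ^n → ℝ^n be L-Lipschitz continuous and β-strongly monotone, let α > 0, and let κ > 0 satisfy ‖P_{Φ(x)}(z) − P_{Φ(y)}(z)‖ ≤ κ‖x − y‖ for all x, y, z ∈ ℝ^n. Suppose x* ∈ ℝ^n satisfies f(x*) = P_{Φ(x*)}(f(x*) − αx*). Then for every x ∈ ℝ^n, 2⟨x − x*, P_{Φ(x)}(f(x) − αx) − f(x)⟩ ≤ (1 + 2κ − 2β + α² + L² − 2αβ)‖x − x*‖². -/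
open scoped RealInnerProductSpace

/-- Two points satisfying the variational characterisation of the projections of `u` and `v` onto a
common set are no further apart than `u` and `v`. -/
theorem norm_sub_sq_le_of_inner_nonpos {E : Type*} [NormedAddCommGroup E] [InnerProductSpace ℝ E]
    {u v a b : E} (ha : ⟪u - a, b - a⟫ ≤ 0) (hb : ⟪v - b, a - b⟫ ≤ 0) :
    ‖a - b‖ ^ 2 ≤ ‖u - v‖ ^ 2 := by
  have hsum : ⟪u - a, b - a⟫ + ⟪v - b, a - b⟫ = ‖a - b‖ ^ 2 - ⟪u - v, a - b⟫ := by
    rw [← real_inner_self_eq_norm_sq]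
    simp only [inner_sub_left, inner_sub_right]
    ring
  have hsq := norm_sub_sq_real (u - v) (a - b)
  nlinarith [sq_nonneg ‖(u - v) - (a - b)‖]

/-- with Φ having nonempty closed convex values, f L-Lipschitz and
β-strongly monotone, α > 0, κ > 0 with ‖P_{Φ(x)}(z) − P_{Φ(y)}(z)‖ ≤ κ‖x − y‖,
and x* satisfying f(x*) = P_{Φ(x*)}(f(x*) − αx*), for every x:
2⟨x − x*, P_{Φ(x)}(f(x) − αx) − f(x)⟩ ≤ (1 + 2κ − 2β + α² + L² − 2αβ)‖x − x*‖². -/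
theorem stmt_10 {n : ℕ} (Φ : EuclideanSpace ℝ (Fin n) → Set (EuclideanSpace ℝ (Fin n)))
    (hΦ : ∀ x, (Φ x).Nonempty ∧ IsClosed (Φ x) ∧ Convex ℝ (Φ x))
    (P : EuclideanSpace ℝ (Fin n) → EuclideanSpace ℝ (Fin n) → EuclideanSpace ℝ (Fin n))
    (hP : ∀ x z, P x z ∈ Φ x ∧ ∀ y ∈ Φ x, ⟪z - P x z, y - P x z⟫ ≤ 0)
    (f : EuclideanSpace ℝ (Fin n) → EuclideanSpace ℝ (Fin n))
    (L β α κ : ℝ)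
    (hLip : ∀ x y, ‖f x - f y‖ ≤ L * ‖x - y‖)
    (hβ : 0 < β)
    (hmono : ∀ x y, β * ‖x - y‖ ^ 2 ≤ ⟪f x - f y, x - y⟫)
    (hα : 0 < α) (hκ : 0 < κ)
    (hPκ : ∀ x y z, ‖P x z - P y z‖ ≤ κ * ‖x - y‖)
    (xs : EuclideanSpace ℝ (Fin n))
    (hxs : f xs = P xs (f xs - α • xs))
    (x : EuclideanSpace ℝ (Fin n)) :
    2 * ⟪x - xs, P x (f x - α • x) - f x⟫ ≤
      (1 + 2 * κ - 2 * β + α ^ 2 + L ^ 2 - 2 * α * β) * ‖x - xs‖ ^ 2 := by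
  set d := x - xs with hd
  set g := f x - f xs with hg
  set u := f x - α • x with hu
  set us := f xs - α • xs with hus
  have hdecomp : P x u - f x = (P x u - P x us) + (P x us - P xs us) - g := by
    rw [hg, ← hxs]
    abel
  have hproj : ‖P x u - P x us‖ ^ 2 ≤ ‖u - us‖ ^ 2 :=
    norm_sub_sq_le_of_inner_nonpos ((hP x u).2 _ (hP x us).1) ((hP x us).2 _ (hP x u).1)
  have hdiff : u - us = g - α • d := by
    rw [hu, hus, hg, hd, smul_sub]
    abel
  have hexp : ‖g - α • d‖ ^ 2 = ‖g‖ ^ 2 - 2 * α * ⟪g, d⟫ + α ^ 2 * ‖d‖ ^ 2 := by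
    rw [norm_sub_sq_real, inner_smul_right, norm_smul, mul_pow, Real.norm_eq_abs, sq_abs]
    ring
  have hg_sq : ‖g‖ ^ 2 ≤ L ^ 2 * ‖d‖ ^ 2 := by
    rw [← mul_pow]
    exact pow_le_pow_left₀ (norm_nonneg _) (hLip x xs) 2
  have hgd : β * ‖d‖ ^ 2 ≤ ⟪g, d⟫ := hmono x xs
  have hαgd : α * (β * ‖d‖ ^ 2) ≤ α * ⟪g, d⟫ := mul_le_mul_of_nonneg_left hgd hα.le
  have hyoung : 2 * ⟪d, P x u - P x us⟫ ≤ ‖d‖ ^ 2 + ‖P x u - P x us‖ ^ 2 := by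
    have := norm_sub_sq_real d (P x u - P x us)
    nlinarith [sq_nonneg ‖d - (P x u - P x us)‖]
  have hvar : ⟪d, P x us - P xs us⟫ ≤ κ * ‖d‖ ^ 2 :=
    calc ⟪d, P x us - P xs us⟫ ≤ ‖d‖ * ‖P x us - P xs us‖ := real_inner_le_norm _ _
      _ ≤ ‖d‖ * (κ * ‖d‖) := mul_le_mul_of_nonneg_left (hPκ x xs us) (norm_nonneg _)
      _ = κ * ‖d‖ ^ 2 := by ring
  rw [hdecomp, inner_sub_right, inner_add_right, real_inner_comm g d]
  rw [hdiff, hexp] at hproj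
  linarith
end

section
/- Let Φ : ℝ^n → 2^{ℝ^n} have nonempty, closed and convex values, let f : ℝ^n → ℝ^n be L-Lipschitz continuous and β-strongly monotone, let α > 0, let κ > 0 satisfy ‖P_{Φ(x)}(z) − P_{Φ(y)}(z)‖ ≤ κ‖x − y‖ for all x, y, z ∈ ℝ^n, and let λ : [t₀, ∞) → (0, ∞) be continuous. Suppose x* satisfies f(x*) = P_{Φ(x*)}(f(x*) − αx*) and x : [t₀, ∞) → ℝ^n is differentiable with ẋ(t) = λ(t)(P_{Φ(x(t))}(f(x(t)) − αx(t)) − f(x(t))) for all t ≥ t₀. Then for all t ≥ t₀, ‖x(t) − x*‖ ≤ ‖x(t₀) − x*‖ · exp(∫_{t₀}^{t} Λ(s) ds), where Λ(s) = λ(s)(1 + 2κ − 2β + α² + L² − 2αβ)/2. -/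
open scoped RealInnerProductSpace

/-- Points satisfying the mutual variational inequalities of nearest-point projections are at most
as far apart as the points they project. -/
theorem norm_sub_le_of_inner_le_zero {E : Type*} [NormedAddCommGroup E] [InnerProductSpace ℝ E]
    {z w p q : E} (hp : ⟪z - p, q - p⟫ ≤ 0) (hq : ⟪w - q, p - q⟫ ≤ 0) :
    ‖p - q‖ ≤ ‖z - w‖ := by
  have key : ‖p - q‖ ^ 2 ≤ ⟪z - w, p - q⟫ := by
    have h : ⟪z - w, p - q⟫ = ‖p - q‖ ^ 2 - ⟪z - p, q - p⟫ - ⟪w - q, p - q⟫ := by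
      rw [← real_inner_self_eq_norm_sq]
      simp only [inner_sub_left, inner_sub_right]
      ring
    linarith
  have hcs := real_inner_le_norm (z - w) (p - q)
  by_contra! hlt
  nlinarith [norm_nonneg (p - q), norm_nonneg (z - w)]

/-- Gronwall's inequality for the norm of a curve whose derivative satisfies a one-sided
linear bound with a continuous time-dependent rate. -/
theorem norm_le_mul_exp_integral_of_inner_deriv_le {E : Type*} [NormedAddCommGroup E]
    [InnerProductSpace ℝ E] {u u' : ℝ → E} {Λ : ℝ → ℝ} {t₀ : ℝ}
    (hΛ : ContinuousOn Λ (Set.Ici t₀))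
    (hu : ∀ t ∈ Set.Ici t₀, HasDerivWithinAt u (u' t) (Set.Ici t₀) t)
    (hle : ∀ t ∈ Set.Ici t₀, ⟪u t, u' t⟫ ≤ Λ t * ‖u t‖ ^ 2) {t : ℝ} (ht : t ∈ Set.Ici t₀) :
    ‖u t‖ ≤ ‖u t₀‖ * Real.exp (∫ s in t₀..t, Λ s) := by
  set M : ℝ → ℝ := fun s => Λ (max t₀ s) with hM
  have hMc : Continuous M :=
    hΛ.comp_continuous (by fun_prop) fun s => le_max_left t₀ s
  have hMΛ : ∀ s ∈ Set.Ici t₀, M s = Λ s := fun s hs => by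
    simp only [hM, max_eq_right (Set.mem_Ici.1 hs)]
  have hint : ∫ s in t₀..t, Λ s = ∫ s in t₀..t, M s := by
    refine intervalIntegral.integral_congr fun s hs => (hMΛ s ?_).symm
    rw [Set.uIcc_of_le ht] at hs
    exact hs.1
  set I : ℝ → ℝ := fun r => ∫ s in t₀..r, M s with hI
  have hId : ∀ r, HasDerivAt I (M r) r := fun r => hMc.integral_hasStrictDerivAt t₀ r |>.hasDerivAt
  have hd : ∀ r ∈ Set.Ici t₀, HasDerivWithinAt (fun r => ‖u r‖ ^ 2 * Real.exp (-2 * I r))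
      (2 * ⟪u r, u' r⟫ * Real.exp (-2 * I r)
        + ‖u r‖ ^ 2 * (Real.exp (-2 * I r) * (-2 * M r))) (Set.Ici t₀) r := fun r hr =>
    (hu r hr).norm_sq.mul (((hId r).const_mul (-2)).exp.hasDerivWithinAt)
  have hanti : AntitoneOn (fun r => ‖u r‖ ^ 2 * Real.exp (-2 * I r)) (Set.Ici t₀) := by
    refine antitoneOn_of_hasDerivWithinAt_nonpos (convex_Ici t₀)
      (fun r hr => (hd r hr).continuousWithinAt)
      (fun r hr => (hd r (interior_subset hr)).mono interior_subset) fun r hr => ?_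
    have hr' := interior_subset hr
    have h := hle r hr'
    rw [← hMΛ r hr'] at h
    nlinarith [mul_le_mul_of_nonneg_right h (Real.exp_pos (-2 * I r)).le]
  have h := hanti Set.self_mem_Ici ht ht
  have hI0 : I t₀ = 0 := intervalIntegral.integral_same
  simp only [hI0, mul_zero, Real.exp_zero, mul_one] at h
  rw [hint]
  refine (sq_le_sq₀ (norm_nonneg _) (by positivity)).1 ?_
  have hexp : Real.exp (-2 * I t) * Real.exp (I t) ^ 2 = 1 := by
    rw [← Real.exp_nat_mul, ← Real.exp_add]
    simp
  calc ‖u t‖ ^ 2 = ‖u t‖ ^ 2 * Real.exp (-2 * I t) * Real.exp (I t) ^ 2 := by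
        rw [mul_assoc, hexp, mul_one]
    _ ≤ ‖u t₀‖ ^ 2 * Real.exp (I t) ^ 2 := by gcongr
    _ = (‖u t₀‖ * Real.exp (I t)) ^ 2 := by ring

/-- Gronwall-type estimate for trajectories of the neural network
ẋ(t) = λ(t)(P_{Φ(x(t))}(f(x(t)) − αx(t)) − f(x(t))) on [t₀, ∞): if x* is an
equilibrium (f(x*) = P_{Φ(x*)}(f(x*) − αx*)), then for all t ≥ t₀,
‖x(t) − x*‖ ≤ ‖x(t₀) − x*‖ · exp(∫_{t₀}^t Λ(s) ds), where
Λ(s) = λ(s)(1 + 2κ − 2β + α² + L² − 2αβ)/2. -/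
theorem stmt_11 {n : ℕ} (Φ : EuclideanSpace ℝ (Fin n) → Set (EuclideanSpace ℝ (Fin n)))
    (hΦ : ∀ x, (Φ x).Nonempty ∧ IsClosed (Φ x) ∧ Convex ℝ (Φ x))
    (P : EuclideanSpace ℝ (Fin n) → EuclideanSpace ℝ (Fin n) → EuclideanSpace ℝ (Fin n))
    (hP : ∀ x z, P x z ∈ Φ x ∧ ∀ y ∈ Φ x, ⟪z - P x z, y - P x z⟫ ≤ 0)
    (f : EuclideanSpace ℝ (Fin n) → EuclideanSpace ℝ (Fin n))
    (L β α κ : ℝ)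
    (hLip : ∀ x y, ‖f x - f y‖ ≤ L * ‖x - y‖)
    (hβ : 0 < β)
    (hmono : ∀ x y, β * ‖x - y‖ ^ 2 ≤ ⟪f x - f y, x - y⟫)
    (hα : 0 < α) (hκ : 0 < κ)
    (hPκ : ∀ x y z, ‖P x z - P y z‖ ≤ κ * ‖x - y‖)
    (t₀ : ℝ) (lam : ℝ → ℝ)
    (hlamc : ContinuousOn lam (Set.Ici t₀))
    (hlampos : ∀ t ∈ Set.Ici t₀, 0 < lam t)
    (xs : EuclideanSpace ℝ (Fin n))
    (hxs : f xs = P xs (f xs - α • xs))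
    (x : ℝ → EuclideanSpace ℝ (Fin n))
    (hx : ∀ t ∈ Set.Ici t₀,
      HasDerivWithinAt x (lam t • (P (x t) (f (x t) - α • x t) - f (x t))) (Set.Ici t₀) t) :
    ∀ t ∈ Set.Ici t₀,
      ‖x t - xs‖ ≤ ‖x t₀ - xs‖ *
        Real.exp (∫ s in t₀..t,
          lam s * (1 + 2 * κ - 2 * β + α ^ 2 + L ^ 2 - 2 * α * β) / 2) := by
  intro t ht
  refine norm_le_mul_exp_integral_of_inner_deriv_le (u := fun t => x t - xs) (by fun_prop)
    (fun s hs => (hx s hs).sub_const xs) (fun s hs => ?_) ht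
  set y := x s
  set p := P y (f y - α • y)
  set q := P y (f xs - α • xs)
  have hproj : ‖p - q‖ ≤ ‖(f y - f xs) - α • (y - xs)‖ := by
    have h := norm_sub_le_of_inner_le_zero ((hP y (f y - α • y)).2 q (hP y _).1)
      ((hP y (f xs - α • xs)).2 p (hP y _).1)
    rwa [show f y - α • y - (f xs - α • xs) = (f y - f xs) - α • (y - xs) by module] at h
  have hstep : ‖(f y - f xs) - α • (y - xs)‖ ^ 2
      ≤ (L ^ 2 - 2 * α * β + α ^ 2) * ‖y - xs‖ ^ 2 := by
    rw [norm_sub_sq_real, inner_smul_right, norm_smul, mul_pow, Real.norm_eq_abs, sq_abs]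
    have h₁ := pow_le_pow_left₀ (norm_nonneg _) (hLip y xs) 2
    have h₂ := mul_le_mul_of_nonneg_left (hmono y xs) hα.le
    linarith
  have hpq : ⟪y - xs, p - q⟫ ≤ (‖y - xs‖ ^ 2 + ‖(f y - f xs) - α • (y - xs)‖ ^ 2) / 2 := by
    have h₁ := real_inner_le_norm (y - xs) (p - q)
    have h₂ := mul_le_mul_of_nonneg_left hproj (norm_nonneg (y - xs))
    linarith [two_mul_le_add_sq ‖y - xs‖ ‖(f y - f xs) - α • (y - xs)‖]
  have hqx : ⟪y - xs, q - f xs⟫ ≤ κ * ‖y - xs‖ ^ 2 := by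
    have h₁ := real_inner_le_norm (y - xs) (q - f xs)
    have h₂ : ‖q - f xs‖ ≤ κ * ‖y - xs‖ := by
      have h := hPκ y xs (f xs - α • xs)
      rwa [← hxs] at h
    nlinarith [mul_le_mul_of_nonneg_left h₂ (norm_nonneg (y - xs))]
  have hf := hmono y xs
  rw [real_inner_comm] at hf
  have hsplit : ⟪y - xs, p - f y⟫
      = ⟪y - xs, p - q⟫ + ⟪y - xs, q - f xs⟫ - ⟪y - xs, f y - f xs⟫ := by
    simp only [inner_sub_right]
    ring
  have hbound : ⟪y - xs, p - f y⟫
      ≤ (1 + 2 * κ - 2 * β + α ^ 2 + L ^ 2 - 2 * α * β) / 2 * ‖y - xs‖ ^ 2 := by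
    linarith
  rw [inner_smul_right]
  calc lam s * ⟪y - xs, p - f y⟫ ≤ lam s * _ :=
        mul_le_mul_of_nonneg_left hbound (hlampos s hs).le
    _ = _ := by ring
end

section
/- Let Φ : ℝ^n → 2^{ℝ^n} have nonempty, closed and convex values, let f : ℝ^n → ℝ^n be L-Lipschitz continuous and β-strongly monotone, let α > 0, let κ > 0 satisfy ‖P_{Φ(x)}(z) − P_{Φ(y)}(z)‖ ≤ κ‖x − y‖ for all x, y, z ∈ ℝ^n, and let λ : [t₀, ∞) → (0, ∞) be continuous. Assume 1 + 2κ − 2β + α² + L² − 2αβ < 0 and ∫_{t₀}^{∞} λ(t) dt = +∞. Suppose x* satisfies f(x*) = P_{Φ(x*)}(f(x*) − αx*) and x : [t₀, ∞) → ℝ^n is differentiable with ẋ(t) = λ(t)(P_{Φ(x(t))}(f(x(t)) − αx(t)) − f(x(t))) for all t ≥ t₀. Then x(t) → x* as t → ∞. -/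
open scoped RealInnerProductSpace

/-- Grönwall-type decay: if `W ≥ 0` satisfies `W' ≤ -c λ W` on `[t₀, ∞)` with `c > 0` and the
integral of `λ` diverges, then `W` tends to `0`. -/
theorem tendsto_zero_of_deriv_le_neg_mul {W W' lam : ℝ → ℝ} {c t₀ : ℝ} (hc : 0 < c)
    (hlam : ContinuousOn lam (Set.Ici t₀))
    (hdiv : Filter.Tendsto (fun t => ∫ s in t₀..t, lam s) Filter.atTop Filter.atTop)
    (hW : ∀ t ∈ Set.Ici t₀, HasDerivWithinAt W (W' t) (Set.Ici t₀) t)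
    (hW_nonneg : ∀ t, 0 ≤ W t)
    (hW' : ∀ t ∈ Set.Ici t₀, W' t ≤ -c * lam t * W t) :
    Filter.Tendsto W Filter.atTop (nhds 0) := by
  set m : ℝ → ℝ := fun s => lam (max s t₀) with hm
  have hmc : Continuous m :=
    hlam.comp_continuous (by fun_prop) fun s => le_max_right s t₀
  have hm_eq : ∀ t ∈ Set.Ici t₀, m t = lam t := fun t ht => by
    simp only [hm, max_eq_left (Set.mem_Ici.1 ht)]
  set I : ℝ → ℝ := fun t => ∫ s in t₀..t, m s with hI
  have hI_deriv : ∀ t, HasDerivAt I (m t) t := fun t => hmc.integral_hasStrictDerivAt t₀ t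
    |>.hasDerivAt
  have hI_eq : ∀ t ∈ Set.Ici t₀, ∫ s in t₀..t, lam s = I t := fun t ht =>
    intervalIntegral.integral_congr fun s hs => by
      rw [Set.uIcc_of_le ht] at hs
      exact (hm_eq s hs.1).symm
  have hG : ∀ t ∈ Set.Ici t₀, HasDerivWithinAt (fun t => W t * Real.exp (c * I t))
      (W' t * Real.exp (c * I t) + W t * (Real.exp (c * I t) * (c * m t))) (Set.Ici t₀) t :=
    fun t ht => (hW t ht).mul (((hI_deriv t).const_mul c).exp.hasDerivWithinAt)
  have hanti : AntitoneOn (fun t => W t * Real.exp (c * I t)) (Set.Ici t₀) := by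
    refine antitoneOn_of_hasDerivWithinAt_nonpos (convex_Ici t₀)
      (fun t ht => (hG t ht).continuousWithinAt)
      (fun t ht => (hG t (interior_subset ht)).mono interior_subset) fun t ht => ?_
    have ht' := interior_subset ht
    rw [hm_eq t ht']
    nlinarith [hW' t ht', Real.exp_pos (c * I t)]
  have hI_top : Filter.Tendsto I Filter.atTop Filter.atTop :=
    hdiv.congr' ((Filter.eventually_ge_atTop t₀).mono hI_eq)
  have hbound : Filter.Tendsto (fun t => W t₀ * Real.exp (-(c * I t))) Filter.atTop (nhds 0) := by
    simpa using (Real.tendsto_exp_neg_atTop_nhds_zero.comp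
      (hI_top.const_mul_atTop hc)).const_mul (W t₀)
  refine tendsto_of_tendsto_of_tendsto_of_le_of_le' tendsto_const_nhds hbound
    (Filter.Eventually.of_forall hW_nonneg) ?_
  filter_upwards [Filter.eventually_ge_atTop t₀] with t ht
  have h := hanti Set.self_mem_Ici ht ht
  have hI₀ : I t₀ = 0 := intervalIntegral.integral_same
  simp only [hI₀, mul_zero, Real.exp_zero, mul_one] at h
  rwa [Real.exp_neg, ← div_eq_mul_inv, le_div_iff₀ (Real.exp_pos _)]

/-- global asymptotic convergence of the neural network
ẋ(t) = λ(t)(P_{Φ(x(t))}(f(x(t)) − αx(t)) − f(x(t))): under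
1 + 2κ − 2β + α² + L² − 2αβ < 0 and ∫_{t₀}^∞ λ(t) dt = +∞ (the partial
integrals tend to +∞), every trajectory converges to the equilibrium x*. -/
theorem stmt_12 {n : ℕ} (Φ : EuclideanSpace ℝ (Fin n) → Set (EuclideanSpace ℝ (Fin n)))
    (hΦ : ∀ x, (Φ x).Nonempty ∧ IsClosed (Φ x) ∧ Convex ℝ (Φ x))
    (P : EuclideanSpace ℝ (Fin n) → EuclideanSpace ℝ (Fin n) → EuclideanSpace ℝ (Fin n))
    (hP : ∀ x z, P x z ∈ Φ x ∧ ∀ y ∈ Φ x, ⟪z - P x z, y - P x z⟫ ≤ 0)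
    (f : EuclideanSpace ℝ (Fin n) → EuclideanSpace ℝ (Fin n))
    (L β α κ : ℝ)
    (hLip : ∀ x y, ‖f x - f y‖ ≤ L * ‖x - y‖)
    (hβ : 0 < β)
    (hmono : ∀ x y, β * ‖x - y‖ ^ 2 ≤ ⟪f x - f y, x - y⟫)
    (hα : 0 < α) (hκ : 0 < κ)
    (hPκ : ∀ x y z, ‖P x z - P y z‖ ≤ κ * ‖x - y‖)
    (hneg : 1 + 2 * κ - 2 * β + α ^ 2 + L ^ 2 - 2 * α * β < 0)
    (t₀ : ℝ) (lam : ℝ → ℝ)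
    (hlamc : ContinuousOn lam (Set.Ici t₀))
    (hlampos : ∀ t ∈ Set.Ici t₀, 0 < lam t)
    (hdiv : Filter.Tendsto (fun t => ∫ s in t₀..t, lam s) Filter.atTop Filter.atTop)
    (xs : EuclideanSpace ℝ (Fin n))
    (hxs : f xs = P xs (f xs - α • xs))
    (x : ℝ → EuclideanSpace ℝ (Fin n))
    (hx : ∀ t ∈ Set.Ici t₀,
      HasDerivWithinAt x (lam t • (P (x t) (f (x t) - α • x t) - f (x t))) (Set.Ici t₀) t) :
    Filter.Tendsto x Filter.atTop (nhds xs) := by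
  have hfield : ∀ y, 2 * ⟪y - xs, P y (f y - α • y) - f y⟫ ≤
      (1 + 2 * κ - 2 * β + α ^ 2 + L ^ 2 - 2 * α * β) * ‖y - xs‖ ^ 2 := by
    intro y
    set z := f y - α • y
    set u := y - xs
    set g := f y - f xs with hg
    have hsplit : P y z - f y = (P y z - P xs z) + (P xs z - P xs (f xs - α • xs)) - g := by
      rw [← hxs, hg]; abel
    have hz : z - (f xs - α • xs) = g - α • u := by
      simp only [z, u, g, smul_sub]; abel
    have h₁ : ⟪u, P y z - P xs z⟫ ≤ ‖u‖ * (κ * ‖u‖) :=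
      (real_inner_le_norm _ _).trans (by gcongr; exact hPκ y xs z)
    have h₂ : ⟪u, P xs z - P xs (f xs - α • xs)⟫ ≤ ‖u‖ * ‖g - α • u‖ :=
      (real_inner_le_norm _ _).trans (by
        gcongr
        exact hz ▸ norm_sub_le_of_variational_inequality (hP xs) z (f xs - α • xs))
    have hgu : β * ‖u‖ ^ 2 ≤ ⟪g, u⟫ := hmono y xs
    have hgL : ‖g‖ ^ 2 ≤ L ^ 2 * ‖u‖ ^ 2 := by
      rw [← mul_pow]
      exact pow_le_pow_left₀ (norm_nonneg _) (hLip y xs) 2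
    have hsq : ‖g - α • u‖ ^ 2 = ‖g‖ ^ 2 - 2 * (α * ⟪g, u⟫) + α ^ 2 * ‖u‖ ^ 2 := by
      rw [norm_sub_sq_real, real_inner_smul_right, norm_smul, mul_pow, Real.norm_eq_abs, sq_abs]
    rw [hsplit, inner_sub_right, inner_add_right, real_inner_comm g u]
    nlinarith [sq_nonneg (‖u‖ - ‖g - α • u‖), mul_le_mul_of_nonneg_left hgu hα.le]
  have hsq : Filter.Tendsto (fun t => ‖x t - xs‖ ^ 2) Filter.atTop (nhds 0) := by
    refine tendsto_zero_of_deriv_le_neg_mul (neg_pos.2 hneg) hlamc hdiv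
      (fun t ht => ((hx t ht).sub_const xs).norm_sq) (fun t => by positivity) fun t ht => ?_
    rw [real_inner_smul_right]
    nlinarith [mul_le_mul_of_nonneg_left (hfield (x t)) (hlampos t ht).le]
  rw [tendsto_iff_norm_sub_tendsto_zero]
  simpa [Real.sqrt_sq] using hsq.sqrt
end

section
/- Let Φ : ℝ^n → 2^{ℝ^n} have nonempty, closed and convex values, let f : ℝ^n → ℝ^n be L-Lipschitz continuous and β-strongly monotone, let α > 0, let κ > 0 satisfy ‖P_{Φ(x)}(z) − P_{Φ(y)}(z)‖ ≤ κ‖x − y‖ for all x, y, z ∈ ℝ^n, and let λ : [t₀, ∞) → (0, ∞) be continuous with λ(t) ≥ λ* > 0 for all t ≥ t₀. Assume 1 + 2κ − 2β + α² + L² − 2αβ < 0. Suppose x* satisfies f(x*) = P_{Φ(x*)}(f(x*) − αx*) and x : [t₀, ∞) → ℝ^n is differentiable with ẋ(t) = λ(t)(P_{Φ(x(t))}(f(x(t)) − αx(t)) − f(x(t))) for all t ≥ t₀. Then ‖x(t) − x*‖ ≤ ‖x(t₀) − x*‖ e^{−ζ(t − t₀)} for all t ≥ t₀, where ζ = −λ*(1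 + 2κ − 2β + α² + L² − 2αβ)/2 > 0; i.e., the network is globally exponentially stable at x*. -/
open scoped RealInnerProductSpace

section
variable {E : Type*} [NormedAddCommGroup E] [InnerProductSpace ℝ E]

/-- Points satisfying the variational inequalities of a projection are no farther apart than
the points being projected. -/
theorem norm_sub_le_of_inner_nonpos {u v a b : E}
    (ha : ⟪u - a, b - a⟫ ≤ 0) (hb : ⟪v - b, a - b⟫ ≤ 0) : ‖a - b‖ ≤ ‖u - v‖ := by
  have h : ‖a - b‖ ^ 2 ≤ ⟪u - v, a - b⟫ := by
    rw [← real_inner_self_eq_norm_sq]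
    simp only [inner_sub_left, inner_sub_right] at *
    linarith
  have hle := h.trans (real_inner_le_norm _ _)
  by_contra! hlt
  nlinarith [norm_nonneg (u - v)]

/-- The vector field `P x (f x - α x) - f x` is one-sided Lipschitz at its zero `y`. -/
theorem inner_projection_field_le {Φ : E → Set E} {P : E → E → E}
    (hP : ∀ x z, P x z ∈ Φ x ∧ ∀ y ∈ Φ x, ⟪z - P x z, y - P x z⟫ ≤ 0)
    {f : E → E} {L β α κ : ℝ} (hLip : ∀ x y, ‖f x - f y‖ ≤ L * ‖x - y‖)
    (hmono : ∀ x y, β * ‖x - y‖ ^ 2 ≤ ⟪f x - f y, x - y⟫) (hα : 0 ≤ α)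
    (hPκ : ∀ x y z, ‖P x z - P y z‖ ≤ κ * ‖x - y‖)
    {y : E} (hy : f y = P y (f y - α • y)) (x : E) :
    2 * ⟪x - y, P x (f x - α • x) - f x⟫ ≤
      (1 + 2 * κ - 2 * β + α ^ 2 + L ^ 2 - 2 * α * β) * ‖x - y‖ ^ 2 := by
  set u := f x - α • x with hu
  set v := f y - α • y with hv
  have hsplit : P x u - f x = (P x u - P y u) + (P y u - P y v) - (f x - f y) := by
    rw [← hy]; abel
  have hvary : ⟪x - y, P x u - P y u⟫ ≤ κ * ‖x - y‖ ^ 2 := by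
    have := mul_le_mul_of_nonneg_left (hPκ x y u) (norm_nonneg (x - y))
    linarith [real_inner_le_norm (x - y) (P x u - P y u)]
  have hproj : ‖P y u - P y v‖ ≤ ‖u - v‖ :=
    norm_sub_le_of_inner_nonpos ((hP y u).2 _ (hP y v).1) ((hP y v).2 _ (hP y u).1)
  have hfix : 2 * ⟪x - y, P y u - P y v⟫ ≤ ‖x - y‖ ^ 2 + ‖u - v‖ ^ 2 := by
    have := mul_le_mul_of_nonneg_left hproj (norm_nonneg (x - y))
    linarith [real_inner_le_norm (x - y) (P y u - P y v), two_mul_le_add_sq ‖x - y‖ ‖u - v‖]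
  have huv : ‖u - v‖ ^ 2 ≤ (L ^ 2 - 2 * α * β + α ^ 2) * ‖x - y‖ ^ 2 := by
    have heq : u - v = (f x - f y) - α • (x - y) := by rw [hu, hv, smul_sub]; abel
    have hsq := pow_le_pow_left₀ (norm_nonneg _) (hLip x y) 2
    have hm := mul_le_mul_of_nonneg_left (hmono x y) hα
    rw [heq, norm_sub_sq_real, real_inner_smul_right, norm_smul, mul_pow, Real.norm_eq_abs,
      sq_abs]
    linarith
  have hm := hmono x y
  rw [hsplit, inner_sub_right, inner_add_right, real_inner_comm (f x - f y)]
  linarith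

/-- A differential inequality `2 ⟪e, e'⟫ ≤ -2 ζ ‖e‖²` forces exponential decay of `‖e‖`. -/
theorem norm_le_mul_exp_of_inner_deriv_le {e e' : ℝ → E} {t₀ ζ : ℝ}
    (he : ∀ t ∈ Set.Ici t₀, HasDerivWithinAt e (e' t) (Set.Ici t₀) t)
    (hle : ∀ t ∈ Set.Ici t₀, 2 * ⟪e t, e' t⟫ ≤ -(2 * ζ) * ‖e t‖ ^ 2) {t : ℝ} (ht : t₀ ≤ t) :
    ‖e t‖ ≤ ‖e t₀‖ * Real.exp (-ζ * (t - t₀)) := by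
  have hderiv : ∀ s ∈ Set.Ici t₀, HasDerivWithinAt
      (fun s => ‖e s‖ ^ 2 * Real.exp (2 * ζ * (s - t₀)))
      (2 * ⟪e s, e' s⟫ * Real.exp (2 * ζ * (s - t₀)) +
        ‖e s‖ ^ 2 * (Real.exp (2 * ζ * (s - t₀)) * (2 * ζ * 1))) (Set.Ici t₀) s := fun s hs =>
    (he s hs).norm_sq.mul
      ((((hasDerivAt_id s).sub_const t₀).const_mul (2 * ζ)).exp.hasDerivWithinAt)
  have hanti : AntitoneOn (fun s => ‖e s‖ ^ 2 * Real.exp (2 * ζ * (s - t₀))) (Set.Ici t₀) := by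
    refine antitoneOn_of_hasDerivWithinAt_nonpos (convex_Ici t₀)
      (fun s hs => (hderiv s hs).continuousWithinAt)
      (fun s hs => (hderiv s (interior_subset hs)).mono interior_subset) fun s hs => ?_
    have := mul_le_mul_of_nonneg_right (hle s (interior_subset hs))
      (Real.exp_pos (2 * ζ * (s - t₀))).le
    linarith
  have hsq := hanti Set.self_mem_Ici ht ht
  simp only [sub_self, mul_zero, Real.exp_zero, mul_one] at hsq
  have hexp : Real.exp (2 * ζ * (t - t₀)) = Real.exp (ζ * (t - t₀)) ^ 2 := by
    rw [← Real.exp_nat_mul]; push_cast; ring_nf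
  rw [hexp, ← mul_pow] at hsq
  rw [neg_mul, Real.exp_neg, ← div_eq_mul_inv, le_div_iff₀ (Real.exp_pos _)]
  exact (sq_le_sq₀ (by positivity) (norm_nonneg _)).1 hsq

end

/-- global exponential stability. If λ(t) ≥ λ* > 0 for all t ≥ t₀
and 1 + 2κ − 2β + α² + L² − 2αβ < 0, then every trajectory of the network
satisfies ‖x(t) − x*‖ ≤ ‖x(t₀) − x*‖ e^{−ζ(t − t₀)} for all t ≥ t₀, where
ζ = −λ*(1 + 2κ − 2β + α² + L² − 2αβ)/2 > 0. -/
theorem stmt_13 {n : ℕ} (Φ : EuclideanSpace ℝ (Fin n) → Set (EuclideanSpace ℝ (Fin n)))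
    (hΦ : ∀ x, (Φ x).Nonempty ∧ IsClosed (Φ x) ∧ Convex ℝ (Φ x))
    (P : EuclideanSpace ℝ (Fin n) → EuclideanSpace ℝ (Fin n) → EuclideanSpace ℝ (Fin n))
    (hP : ∀ x z, P x z ∈ Φ x ∧ ∀ y ∈ Φ x, ⟪z - P x z, y - P x z⟫ ≤ 0)
    (f : EuclideanSpace ℝ (Fin n) → EuclideanSpace ℝ (Fin n))
    (L β α κ : ℝ)
    (hLip : ∀ x y, ‖f x - f y‖ ≤ L * ‖x - y‖)
    (hβ : 0 < β)
    (hmono : ∀ x y, β * ‖x - y‖ ^ 2 ≤ ⟪f x - f y, x - y⟫)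
    (hα : 0 < α) (hκ : 0 < κ)
    (hPκ : ∀ x y z, ‖P x z - P y z‖ ≤ κ * ‖x - y‖)
    (hneg : 1 + 2 * κ - 2 * β + α ^ 2 + L ^ 2 - 2 * α * β < 0)
    (t₀ : ℝ) (lam : ℝ → ℝ) (lamStar : ℝ)
    (hlamc : ContinuousOn lam (Set.Ici t₀))
    (hlamStar : 0 < lamStar)
    (hlamlb : ∀ t ∈ Set.Ici t₀, lamStar ≤ lam t)
    (xs : EuclideanSpace ℝ (Fin n))
    (hxs : f xs = P xs (f xs - α • xs))
    (x : ℝ → EuclideanSpace ℝ (Fin n))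
    (hx : ∀ t ∈ Set.Ici t₀,
      HasDerivWithinAt x (lam t • (P (x t) (f (x t) - α • x t) - f (x t))) (Set.Ici t₀) t) :
    0 < -lamStar * (1 + 2 * κ - 2 * β + α ^ 2 + L ^ 2 - 2 * α * β) / 2 ∧
    ∀ t ∈ Set.Ici t₀,
      ‖x t - xs‖ ≤ ‖x t₀ - xs‖ *
        Real.exp (-(-lamStar * (1 + 2 * κ - 2 * β + α ^ 2 + L ^ 2 - 2 * α * β) / 2)
          * (t - t₀)) := by
  refine ⟨by nlinarith, fun t ht => ?_⟩
  refine norm_le_mul_exp_of_inner_deriv_le (e := fun s => x s - xs)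
    (fun s hs => (hx s hs).sub_const xs) (fun s hs => ?_) ht
  have hlam := hlamlb s hs
  have hfield := mul_le_mul_of_nonneg_left
    (inner_projection_field_le hP hLip hmono hα.le hPκ hxs (x s)) (hlamStar.le.trans hlam)
  have hrate := mul_le_mul_of_nonpos_right hlam
    (mul_nonpos_of_nonpos_of_nonneg hneg.le (sq_nonneg ‖x s - xs‖))
  rw [real_inner_smul_right]
  linarith
end

section
/- Let Ω ⊆ ℝ^n be nonempty, closed and convex, let s : ℝ^n → ℝ^n be l-Lipschitz continuous, set Φ(x) = s(x) + Ω, and let f : ℝ^n → ℝ^n be L-Lipschitz continuous and β-strongly monotone with β > l. Let α > (L² + l²)/(2(β − l)) and suppose x* solves the IQVIP (f(x*) ∈ Φ(x*) and ⟨x*, y − f(x*)⟩ ≥ 0 for all y ∈ Φ(x*)). Then for every x ∈ ℝ^n, writing y_x = P_{Φ(x)}(f(x) − αx), we have ‖y_x − f(x)‖² ≤ (2α²(β − l)/(2α(β − l) − (L² + l²))) · ⟨x − x*, f(x) − y_x⟩. -/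
open scoped RealInnerProductSpace

/-- The quantitative core of the residual bound: `r` is the residual, `d` the distance to the
solution, and `e`, `F` the increments of a Lipschitz and of a strongly monotone map along `d`. -/
theorem norm_sq_le_of_residual_inner_nonpos {E : Type*} [NormedAddCommGroup E]
    [InnerProductSpace ℝ E] {r d e F : E} {l L β α : ℝ} (hα : 0 < α) (hβl : 0 < β - l)
    (hden : 0 < 2 * α * (β - l) - (L ^ 2 + l ^ 2)) (he : ‖e‖ ≤ l * ‖d‖) (hF : ‖F‖ ≤ L * ‖d‖)
    (hmono : β * ‖d‖ ^ 2 ≤ ⟪F, d⟫) (hr : ⟪r - α • d, r + e - F⟫ ≤ 0) :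
    ‖r‖ ^ 2 ≤ 2 * α ^ 2 * (β - l) / (2 * α * (β - l) - (L ^ 2 + l ^ 2)) * ⟪d, r⟫ := by
  have hre : -(l * (‖r‖ * ‖d‖)) ≤ ⟪r, e⟫ := by
    have h := neg_le_of_abs_le (abs_real_inner_le_norm r e)
    nlinarith [mul_le_mul_of_nonneg_left he (norm_nonneg r)]
  have hrF : ⟪r, F⟫ ≤ L * (‖r‖ * ‖d‖) := by
    have h := real_inner_le_norm r F
    nlinarith [mul_le_mul_of_nonneg_left hF (norm_nonneg r)]
  have hde : ⟪d, e⟫ ≤ l * ‖d‖ ^ 2 := by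
    have h := real_inner_le_norm d e
    nlinarith [mul_le_mul_of_nonneg_left he (norm_nonneg d)]
  simp only [inner_sub_left, inner_sub_right, inner_add_right, real_inner_smul_left,
    real_inner_self_eq_norm_sq] at hr
  rw [real_inner_comm d F] at hmono
  have hmain : ‖r‖ ^ 2 - (L + l) * (‖r‖ * ‖d‖) + α * (β - l) * ‖d‖ ^ 2 ≤ α * ⟪d, r⟫ := by
    nlinarith [mul_le_mul_of_nonneg_left hde hα.le, mul_le_mul_of_nonneg_left hmono hα.le]
  rw [div_mul_eq_mul_div, le_div_iff₀ hden]
  have hαk : 0 < α * (β - l) := mul_pos hα hβl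
  have hscaled := mul_le_mul_of_nonneg_left hmain (mul_pos two_pos hαk).le
  have hyoung := sq_nonneg (2 * (α * (β - l)) * ‖d‖ - (L + l) * ‖r‖)
  have hLl := mul_nonneg (sq_nonneg (L - l)) (sq_nonneg ‖r‖)
  linarith

/-- with Ω nonempty closed convex, s l-Lipschitz, Φ(x) = s(x) + Ω,
f L-Lipschitz and β-strongly monotone with β > l, α > (L² + l²)/(2(β − l)),
and x* a solution of the IQVIP, for every x, with y_x = P_{Φ(x)}(f(x) − αx):
‖y_x − f(x)‖² ≤ (2α²(β − l)/(2α(β − l) − (L² + l²))) ⟨x − x*, f(x) − y_x⟩. -/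
theorem stmt_16 {n : ℕ} (Ω : Set (EuclideanSpace ℝ (Fin n)))
    (hΩne : Ω.Nonempty) (hΩcl : IsClosed Ω) (hΩconv : Convex ℝ Ω)
    (s : EuclideanSpace ℝ (Fin n) → EuclideanSpace ℝ (Fin n))
    (l : ℝ)
    (hsLip : ∀ x y, ‖s x - s y‖ ≤ l * ‖x - y‖)
    (Φ : EuclideanSpace ℝ (Fin n) → Set (EuclideanSpace ℝ (Fin n)))
    (hΦ : ∀ x, Φ x = (s x + ·) '' Ω)
    (P : EuclideanSpace ℝ (Fin n) → EuclideanSpace ℝ (Fin n) → EuclideanSpace ℝ (Fin n))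
    (hP : ∀ x z, P x z ∈ Φ x ∧ ∀ y ∈ Φ x, ⟪z - P x z, y - P x z⟫ ≤ 0)
    (f : EuclideanSpace ℝ (Fin n) → EuclideanSpace ℝ (Fin n))
    (L β α : ℝ)
    (hLip : ∀ x y, ‖f x - f y‖ ≤ L * ‖x - y‖)
    (hβ : 0 < β)
    (hmono : ∀ x y, β * ‖x - y‖ ^ 2 ≤ ⟪f x - f y, x - y⟫)
    (hβl : l < β)
    (hα : (L ^ 2 + l ^ 2) / (2 * (β - l)) < α)
    (xs : EuclideanSpace ℝ (Fin n))
    (hxs : f xs ∈ Φ xs ∧ ∀ y ∈ Φ xs, 0 ≤ ⟪xs, y - f xs⟫)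
    (x : EuclideanSpace ℝ (Fin n)) :
    ‖P x (f x - α • x) - f x‖ ^ 2 ≤
      (2 * α ^ 2 * (β - l) / (2 * α * (β - l) - (L ^ 2 + l ^ 2))) *
        ⟪x - xs, f x - P x (f x - α • x)⟫ := by
  have hk : 0 < β - l := sub_pos.mpr hβl
  have hα0 : 0 < α := lt_of_le_of_lt (by positivity) hα
  have hden : 0 < 2 * α * (β - l) - (L ^ 2 + l ^ 2) := by
    rw [div_lt_iff₀ (by positivity)] at hα
    linarith
  obtain ⟨hyΦ, hyproj⟩ := hP x (f x - α • x)
  set y := P x (f x - α • x)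
  obtain ⟨hfxs, hsol⟩ := hxs
  rw [hΦ] at hyΦ hfxs
  obtain ⟨w, hw, hwy⟩ := hyΦ
  obtain ⟨v, hv, hvf⟩ := hfxs
  have hproj := hyproj (s x + v) (by rw [hΦ]; exact ⟨v, hv, rfl⟩)
  have hvi := hsol (s xs + w) (by rw [hΦ]; exact ⟨w, hw, rfl⟩)
  dsimp only at hwy hvf
  have hkey : ⟪(f x - y) - α • (x - xs), (f x - y) + (s x - s xs) - (f x - f xs)⟫ ≤ 0 := by
    have h₁ : s x + v - y = (f x - y) + (s x - s xs) - (f x - f xs) := by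
      rw [← hvf]; abel
    have h₂ : s xs + w - f xs = -((f x - y) + (s x - s xs) - (f x - f xs)) := by
      rw [← hwy]; abel
    have h₃ : f x - α • x - y = (f x - y) - α • (x - xs) - α • xs := by
      rw [smul_sub]; abel
    rw [h₁, h₃, inner_sub_left, real_inner_smul_left] at hproj
    rw [h₂, inner_neg_right] at hvi
    nlinarith
  rw [norm_sub_rev]
  exact norm_sq_le_of_residual_inner_nonpos hα0 hk hden (hsLip x xs) (hLip x xs) (hmono x xs) hkey
end

section
/- Let Ω ⊆ ℝ^n be nonempty, closed and convex, let s : ℝ^n → ℝ^n be l-Lipschitz continuous, set Φ(x) = s(x) + Ω, and let f : ℝ^n → ℝ^n be L-Lipschitz continuous and β-strongly monotone with β > l. Let α > (L² + l²)/(2(β − l)) and suppose x* solves the IQVIP. Suppose 0 < λ < (2α(β − l) − (L² + l²))/(α²(β − l)). Then for every x ∈ ℝ^n, the point x₊ = x + λ(P_{Φ(x)}(f(x) − αx) − f(x)) satisfies ‖x₊ − x*‖² ≤ (1 − λC₁ + λ²C₂)‖x − x*‖², where C₁ = (2α(β − l) − (L² + l²))/α and C₂ = α(β − l). -/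
open scoped RealInnerProductSpace

/-- Endpoint inequalities in the step size `t`, interpolated linearly: the scalar core of the
one-step estimate, with `m = ‖u‖`, `N = ‖p‖` and `A = ⟪u, p⟫`. -/
lemma step_bound_of_scalar {m N A B α b L l t : ℝ} (hα : 0 < α) (hb : 0 < b) (ht : 0 < t)
    (ht' : t * (α ^ 2 * b) < 2 * α * b - (L ^ 2 + l ^ 2))
    (h : N ^ 2 + B + α * A + α * (b * m ^ 2) ≤ 0) (hB : -B ≤ N * (L * m) + N * (l * m)) :
    m ^ 2 + 2 * t * A + t ^ 2 * N ^ 2 ≤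
      (1 - t * ((2 * α * b - (L ^ 2 + l ^ 2)) / α) + t ^ 2 * (α * b)) * m ^ 2 := by
  set κ := 2 * α * b - (L ^ 2 + l ^ 2) with hκ
  have hκpos : 0 < κ := lt_trans (by positivity) ht'
  have h_zero : 2 * α * A + κ * m ^ 2 ≤ 0 := by
    rw [hκ]
    nlinarith [sq_nonneg (N - L * m), sq_nonneg (N - l * m)]
  have h_max : 2 * A * (α ^ 2 * b) + κ * N ^ 2 ≤ 0 := by
    have h' : α * b * (N ^ 2 + B + α * A + α * (b * m ^ 2)) ≤ 0 :=
      mul_nonpos_of_nonneg_of_nonpos (by positivity) h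
    have hB' : α * b * -B ≤ α * b * (N * (L * m) + N * (l * m)) :=
      mul_le_mul_of_nonneg_left hB (by positivity)
    rw [hκ]
    nlinarith [sq_nonneg (L * N - α * b * m), sq_nonneg (l * N - α * b * m)]
  have h_mid : 2 * α * A + t * α * N ^ 2 + κ * m ^ 2 - t * (α ^ 2 * b) * m ^ 2 ≤ 0 := by
    have h₁ := mul_nonpos_of_nonneg_of_nonpos (sub_nonneg.2 ht'.le) h_zero
    have h₂ : t * α * (2 * A * (α ^ 2 * b) + κ * N ^ 2) ≤ 0 :=
      mul_nonpos_of_nonneg_of_nonpos (by positivity) h_max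
    refine nonpos_of_mul_nonpos_right (a := κ) ?_ hκpos
    linear_combination h₁ + h₂
  have h_div : t / α * (2 * α * A + t * α * N ^ 2 + κ * m ^ 2 - t * (α ^ 2 * b) * m ^ 2) ≤ 0 :=
    mul_nonpos_of_nonneg_of_nonpos (by positivity) h_mid
  have h_eq : t / α * (2 * α * A + t * α * N ^ 2 + κ * m ^ 2 - t * (α ^ 2 * b) * m ^ 2) =
      2 * t * A + t ^ 2 * N ^ 2 + t * (κ / α) * m ^ 2 - t ^ 2 * (α * b) * m ^ 2 := by
    field_simp
  linarith

/-- one-step estimate for the discretized network. With Ω nonempty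
closed convex, s l-Lipschitz, Φ(x) = s(x) + Ω, f L-Lipschitz and β-strongly
monotone with β > l, α > (L² + l²)/(2(β − l)), x* a solution of the IQVIP, and
0 < λ < (2α(β − l) − (L² + l²))/(α²(β − l)), the point
x₊ = x + λ(P_{Φ(x)}(f(x) − αx) − f(x)) satisfies
‖x₊ − x*‖² ≤ (1 − λC₁ + λ²C₂)‖x − x*‖², where
C₁ = (2α(β − l) − (L² + l²))/α and C₂ = α(β − l). -/
theorem stmt_17 {n : ℕ} (Ω : Set (EuclideanSpace ℝ (Fin n)))
    (hΩne : Ω.Nonempty) (hΩcl : IsClosed Ω) (hΩconv : Convex ℝ Ω)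
    (s : EuclideanSpace ℝ (Fin n) → EuclideanSpace ℝ (Fin n))
    (l : ℝ)
    (hsLip : ∀ x y, ‖s x - s y‖ ≤ l * ‖x - y‖)
    (Φ : EuclideanSpace ℝ (Fin n) → Set (EuclideanSpace ℝ (Fin n)))
    (hΦ : ∀ x, Φ x = (s x + ·) '' Ω)
    (P : EuclideanSpace ℝ (Fin n) → EuclideanSpace ℝ (Fin n) → EuclideanSpace ℝ (Fin n))
    (hP : ∀ x z, P x z ∈ Φ x ∧ ∀ y ∈ Φ x, ⟪z - P x z, y - P x z⟫ ≤ 0)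
    (f : EuclideanSpace ℝ (Fin n) → EuclideanSpace ℝ (Fin n))
    (L β α lam : ℝ)
    (hLip : ∀ x y, ‖f x - f y‖ ≤ L * ‖x - y‖)
    (hβ : 0 < β)
    (hmono : ∀ x y, β * ‖x - y‖ ^ 2 ≤ ⟪f x - f y, x - y⟫)
    (hβl : l < β)
    (hα : (L ^ 2 + l ^ 2) / (2 * (β - l)) < α)
    (xs : EuclideanSpace ℝ (Fin n))
    (hxs : f xs ∈ Φ xs ∧ ∀ y ∈ Φ xs, 0 ≤ ⟪xs, y - f xs⟫)
    (hlam0 : 0 < lam)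
    (hlam1 : lam < (2 * α * (β - l) - (L ^ 2 + l ^ 2)) / (α ^ 2 * (β - l)))
    (x : EuclideanSpace ℝ (Fin n)) :
    ‖(x + lam • (P x (f x - α • x) - f x)) - xs‖ ^ 2 ≤
      (1 - lam * ((2 * α * (β - l) - (L ^ 2 + l ^ 2)) / α)
         + lam ^ 2 * (α * (β - l))) * ‖x - xs‖ ^ 2 := by
  have hb : 0 < β - l := sub_pos.2 hβl
  have hα0 : 0 < α := lt_of_le_of_lt (by positivity) hα
  obtain ⟨hPmem, hPvar⟩ := hP x (f x - α • x)
  set p := P x (f x - α • x) - f x with hp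
  have hPx : P x (f x - α • x) = f x + p := by rw [hp]; abel
  rw [hPx] at hPmem hPvar
  rw [hΦ] at hPmem hPvar
  rw [hΦ] at hxs
  obtain ⟨⟨w, hw, hwx⟩, hsol⟩ := hxs
  obtain ⟨v, hv, hvx⟩ := hPmem
  have h_proj := hPvar _ ⟨w, hw, rfl⟩
  have h_sol := hsol _ ⟨v, hv, rfl⟩
  dsimp only at hwx hvx h_proj h_sol
  set u := x - xs with hu
  set F := f x - f xs with hF
  set S := s x - s xs with hS
  have e₁ : s x + w - (f x + p) = -(p + (F - S)) := by
    rw [hF, hS, ← hwx]; abel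
  have e₂ : s xs + v - f xs = p + (F - S) := by
    have : v = f x + p - s x := by rw [← hvx]; abel
    rw [this, hF, hS]; abel
  have e₃ : f x - α • x - (f x + p) = -(p + α • u) - α • xs := by
    rw [hu, smul_sub]; abel
  rw [e₁, e₃] at h_proj
  rw [e₂] at h_sol
  have h_key : ⟪p + α • u, p + (F - S)⟫ ≤ 0 := by
    have := mul_nonneg hα0.le h_sol
    rw [inner_neg_right, inner_sub_left, inner_neg_left, real_inner_smul_left] at h_proj
    linarith
  simp only [inner_add_left, inner_add_right, inner_sub_right, real_inner_smul_left,
    real_inner_self_eq_norm_sq] at h_key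
  have h_uF : β * ‖u‖ ^ 2 ≤ ⟪u, F⟫ := by
    rw [real_inner_comm]; exact hmono x xs
  have h_uS : ⟪u, S⟫ ≤ l * ‖u‖ ^ 2 := by
    have := mul_le_mul_of_nonneg_left (hsLip x xs) (norm_nonneg u)
    linarith [real_inner_le_norm u S]
  have h_pF : -⟪p, F⟫ ≤ ‖p‖ * (L * ‖u‖) :=
    (neg_le.1 (neg_le_of_abs_le (abs_real_inner_le_norm p F))).trans
      (mul_le_mul_of_nonneg_left (hLip x xs) (norm_nonneg p))
  have h_pS : ⟪p, S⟫ ≤ ‖p‖ * (l * ‖u‖) :=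
    (real_inner_le_norm p S).trans (mul_le_mul_of_nonneg_left (hsLip x xs) (norm_nonneg p))
  have e₄ : x + lam • p - xs = u + lam • p := by rw [hu]; abel
  rw [e₄, norm_add_sq_real, real_inner_smul_right, norm_smul, mul_pow, Real.norm_eq_abs, sq_abs,
    ← mul_assoc]
  refine step_bound_of_scalar (B := ⟪p, F⟫ - ⟪p, S⟫) hα0 hb hlam0
    ((lt_div_iff₀ (by positivity)).1 hlam1) ?_ (by linarith)
  have h_mono := mul_le_mul_of_nonneg_left h_uF hα0.le
  have h_lip := mul_le_mul_of_nonneg_left h_uS hα0.le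
  linarith
end

section
/- Let Ω ⊆ ℝ^n be nonempty, closed and convex, let s : ℝ^n → ℝ^n be l-Lipschitz continuous, set Φ(x) = s(x) + Ω, and let f : ℝ^n → ℝ^n be L-Lipschitz continuous and β-strongly monotone with β > l and α > (L² + l²)/(2(β − l)). Let (λ_n) satisfy 0 < A < λ_n < B for all n with 0 < B²/A < (2α(β − l) − (L² + l²))/(α²(β − l)), and let x* be the unique solution of the IQVIP. Define the sequence x_{n+1} = x_n + λ_n(P_{Φ(x_n)}(f(x_n) − αx_n) − f(x_n)) from any initial point x₀ ∈ ℝ^n. Then, with C₁ = (2α(β − l) − (L² + l²))/α, C₂ = α(β − l) and r = 1 − AC₁ + B²C₂, one has r < 1, ‖x_{n+1} − x*‖² ≤ r‖x_n − x*‖² for every n, and consequently x_n converges to x*. -/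
open scoped RealInnerProductSpace

section

variable {E : Type*} [NormedAddCommGroup E] [InnerProductSpace ℝ E]

/-- The variational characterizations of two projections onto translates of the same set
combine into a monotonicity inequality between the displacement `p - fx` and `x - xs`. -/
lemma inner_smul_add_displacement_nonpos {Ω : Set E} {x xs fx fxs sx sxs p : E} {α : ℝ}
    (hα : 0 < α) (hp : p ∈ (sx + ·) '' Ω)
    (hproj : ∀ y ∈ (sx + ·) '' Ω, ⟪fx - α • x - p, y - p⟫ ≤ 0)
    (hfxs : fxs ∈ (sxs + ·) '' Ω) (hsol : ∀ y ∈ (sxs + ·) '' Ω, 0 ≤ ⟪xs, y - fxs⟫) :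
    ⟪α • (x - xs) + (p - fx), (p - fx) + ((fx - fxs) - (sx - sxs))⟫ ≤ 0 := by
  obtain ⟨w, hw, rfl⟩ := hp
  obtain ⟨v, hv, rfl⟩ := hfxs
  have h1 := hproj _ ⟨v, hv, rfl⟩
  have h2 := mul_nonneg hα.le (hsol _ ⟨w, hw, rfl⟩)
  simp only [add_sub_add_left_eq_sub] at h1 h2
  have e1 : (sx + w - fx) + ((fx - (sxs + v)) - (sx - sxs)) = w - v := by abel
  have e2 : α • (x - xs) + (sx + w - fx) = -(fx - α • x - (sx + w)) - α • xs := by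
    rw [smul_sub]; abel
  have e3 : v - w = -(w - v) := by abel
  rw [e3, inner_neg_right] at h1
  rw [e1, e2, inner_sub_left, inner_neg_left, real_inner_smul_left]
  linarith

/-- One-step contraction estimate for a relaxed step `u + r • t`. -/
lemma norm_add_smul_sq_le {u t h : E} {α d M A B r : ℝ} (hα : 0 < α) (hd : 0 < d)
    (hM : 0 ≤ M) (hA : 0 < A) (hAr : A < r) (hrB : r < B)
    (hstep : B ^ 2 * (α * d) < A * ((2 * α * d - M) / α))
    (hmono : d * ‖u‖ ^ 2 ≤ ⟪h, u⟫) (hh : ‖h‖ ^ 2 ≤ 2 * M * ‖u‖ ^ 2)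
    (ht : ⟪α • u + t, t + h⟫ ≤ 0) :
    ‖u + r • t‖ ^ 2 ≤ (1 - A * ((2 * α * d - M) / α) + B ^ 2 * (α * d)) * ‖u‖ ^ 2 := by
  have hr : 0 < r := hA.trans hAr
  rw [inner_add_left, inner_add_right, inner_add_right, real_inner_smul_left,
    real_inner_smul_left, real_inner_self_eq_norm_sq, real_inner_comm h u,
    real_inner_comm h t] at ht
  have hsq : 0 ≤ ‖h‖ ^ 2 + 4 * ⟪h, t⟫ + 4 * ‖t‖ ^ 2 := by
    have := sq_nonneg ‖h + (2 : ℝ) • t‖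
    rw [norm_add_sq_real, real_inner_smul_right, norm_smul, mul_pow, Real.norm_eq_abs,
      sq_abs] at this
    linarith
  have hcs : ⟪h, t⟫ ^ 2 ≤ ‖h‖ ^ 2 * ‖t‖ ^ 2 := by
    rw [← mul_pow, ← sq_abs]
    exact pow_le_pow_left₀ (abs_nonneg _) (abs_real_inner_le_norm h t) 2
  rw [norm_add_sq_real, real_inner_smul_right, norm_smul, mul_pow, Real.norm_eq_abs, sq_abs]
  have hU : 0 ≤ ‖u‖ ^ 2 := by positivity
  have hT : 0 ≤ ‖t‖ ^ 2 := by positivity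
  generalize ‖u‖ ^ 2 = U at *
  generalize ‖t‖ ^ 2 = T at *
  generalize ‖h‖ ^ 2 = H at *
  generalize ⟪u, t⟫ = a at *
  generalize ⟪h, u⟫ = b at *
  generalize ⟪h, t⟫ = e at *
  have hbase : 2 * (α * a) ≤ -2 * T - 2 * α * (d * U) - 2 * e := by
    have := mul_le_mul_of_nonneg_left hmono hα.le
    linarith
  have hcross : 0 ≤ M * T + 2 * (α * d) * e + 2 * (α * d) ^ 2 * U := by
    have h1 : (2 * (α * d) * e) ^ 2 ≤ (M * T + 2 * (α * d) ^ 2 * U) ^ 2 := by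
      have h2 : e ^ 2 ≤ 2 * M * U * T := hcs.trans (mul_le_mul_of_nonneg_right hh hT)
      have h3 := mul_le_mul_of_nonneg_left h2 (by positivity : 0 ≤ 4 * (α * d) ^ 2)
      nlinarith [sq_nonneg (M * T - 2 * (α * d) ^ 2 * U)]
    have := (abs_le_of_sq_le_sq' h1 (by positivity)).1
    linarith
  have hC₂ : 0 < α * d := mul_pos hα hd
  have hfirst : 2 * a ≤ -((2 * α * d - M) / α) * U := by
    have : -((2 * α * d - M) / α) * U = -((2 * α * d - M) * U) / α := by ring
    rw [this, le_div_iff₀ hα]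
    linarith
  have hsecond : α * d * (2 * a) + (2 * α * d - M) / α * T ≤ 0 := by
    have : α * d * (2 * a) + (2 * α * d - M) / α * T
        = (α * d * (2 * (α * a)) + (2 * α * d - M) * T) / α := by field_simp
    rw [this]
    refine div_nonpos_of_nonpos_of_nonneg ?_ hα.le
    have := mul_le_mul_of_nonneg_left hbase hC₂.le
    linarith
  generalize (2 * α * d - M) / α = C₁ at *
  generalize α * d = C₂ at *
  have hB2 : r ^ 2 ≤ B ^ 2 := pow_le_pow_left₀ hr.le hrB.le 2
  have hC₁ : 0 < C₁ := by
    have : 0 < A * C₁ := lt_of_le_of_lt (by positivity) hstep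
    exact pos_of_mul_pos_right this hA.le
  have hrC : r * C₂ < C₁ := by
    refine lt_of_mul_lt_mul_left ?_ hr.le
    nlinarith [mul_le_mul_of_nonneg_right hB2 hC₂.le, mul_lt_mul_of_pos_right hAr hC₁]
  have hkey : 2 * a + r * T ≤ -C₁ * U + r * C₂ * U := by
    refine le_of_mul_le_mul_left ?_ hC₁
    have h1 := mul_le_mul_of_nonneg_left hfirst (sub_nonneg.2 hrC.le)
    have h2 := mul_le_mul_of_nonneg_left hsecond hr.le
    linarith
  have h1 := mul_le_mul_of_nonneg_left hkey hr.le
  have h2 := mul_le_mul_of_nonneg_right hAr.le (mul_nonneg hC₁.le hU)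
  have h3 := mul_le_mul_of_nonneg_right hB2 (mul_nonneg hC₂.le hU)
  linarith

end

/-- A sequence whose squared distance to `a` contracts by a factor `q < 1` tends to `a`. -/
lemma tendsto_of_norm_sub_sq_le_mul {F : Type*} [NormedAddCommGroup F] {x : ℕ → F} {a : F} {q : ℝ}
    (hq : q < 1) (hx : ∀ k, ‖x (k + 1) - a‖ ^ 2 ≤ q * ‖x k - a‖ ^ 2) :
    Filter.Tendsto x Filter.atTop (nhds a) := by
  have hgeom : ∀ k, ‖x k - a‖ ^ 2 ≤ max q 0 ^ k * ‖x 0 - a‖ ^ 2 := by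
    intro k
    induction k with
    | zero => simp
    | succ k ih =>
      calc ‖x (k + 1) - a‖ ^ 2 ≤ q * ‖x k - a‖ ^ 2 := hx k
        _ ≤ max q 0 * ‖x k - a‖ ^ 2 := by gcongr; exact le_max_left _ _
        _ ≤ max q 0 * (max q 0 ^ k * ‖x 0 - a‖ ^ 2) := by gcongr
        _ = max q 0 ^ (k + 1) * ‖x 0 - a‖ ^ 2 := by ring
  have hpow : Filter.Tendsto (fun k => max q 0 ^ k * ‖x 0 - a‖ ^ 2) Filter.atTop (nhds 0) := by
    simpa using (tendsto_pow_atTop_nhds_zero_of_lt_one (le_max_right q 0)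
      (max_lt hq one_pos)).mul_const (‖x 0 - a‖ ^ 2)
  have hsq := squeeze_zero (fun k => sq_nonneg ‖x k - a‖) hgeom hpow
  rw [tendsto_iff_norm_sub_tendsto_zero]
  simpa using hsq.sqrt

/-- convergence of the discretized network. With Ω nonempty closed
convex, s l-Lipschitz, Φ(x) = s(x) + Ω, f L-Lipschitz and β-strongly monotone
with β > l and α > (L² + l²)/(2(β − l)); step sizes 0 < A < λₙ < B with
0 < B²/A < (2α(β − l) − (L² + l²))/(α²(β − l)); x* the unique IQVIP solution;
and the iteration x_{k+1} = x_k + λ_k(P_{Φ(x_k)}(f(x_k) − αx_k) − f(x_k))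
started at an arbitrary x₀: with C₁ = (2α(β − l) − (L² + l²))/α,
C₂ = α(β − l), r = 1 − AC₁ + B²C₂, we have r < 1,
‖x_{k+1} − x*‖² ≤ r‖x_k − x*‖² for every k, and x_k → x*. -/
theorem stmt_18 {n : ℕ} (Ω : Set (EuclideanSpace ℝ (Fin n)))
    (hΩne : Ω.Nonempty) (hΩcl : IsClosed Ω) (hΩconv : Convex ℝ Ω)
    (s : EuclideanSpace ℝ (Fin n) → EuclideanSpace ℝ (Fin n))
    (l : ℝ)
    (hsLip : ∀ x y, ‖s x - s y‖ ≤ l * ‖x - y‖)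
    (Φ : EuclideanSpace ℝ (Fin n) → Set (EuclideanSpace ℝ (Fin n)))
    (hΦ : ∀ x, Φ x = (s x + ·) '' Ω)
    (P : EuclideanSpace ℝ (Fin n) → EuclideanSpace ℝ (Fin n) → EuclideanSpace ℝ (Fin n))
    (hP : ∀ x z, P x z ∈ Φ x ∧ ∀ y ∈ Φ x, ⟪z - P x z, y - P x z⟫ ≤ 0)
    (f : EuclideanSpace ℝ (Fin n) → EuclideanSpace ℝ (Fin n))
    (L β α A B : ℝ) (lam : ℕ → ℝ)
    (hLip : ∀ x y, ‖f x - f y‖ ≤ L * ‖x - y‖)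
    (hβ : 0 < β)
    (hmono : ∀ x y, β * ‖x - y‖ ^ 2 ≤ ⟪f x - f y, x - y⟫)
    (hβl : l < β)
    (hα : (L ^ 2 + l ^ 2) / (2 * (β - l)) < α)
    (hA : 0 < A)
    (hlam : ∀ k, A < lam k ∧ lam k < B)
    (hB : 0 < B ^ 2 / A)
    (hstep : B ^ 2 / A < (2 * α * (β - l) - (L ^ 2 + l ^ 2)) / (α ^ 2 * (β - l)))
    (xs : EuclideanSpace ℝ (Fin n))
    (hxs : f xs ∈ Φ xs ∧ ∀ y ∈ Φ xs, 0 ≤ ⟪xs, y - f xs⟫)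
    (hxsuniq : ∀ w : EuclideanSpace ℝ (Fin n),
      (f w ∈ Φ w ∧ ∀ y ∈ Φ w, 0 ≤ ⟪w, y - f w⟫) → w = xs)
    (x : ℕ → EuclideanSpace ℝ (Fin n))
    (hrec : ∀ k, x (k + 1) = x k + lam k • (P (x k) (f (x k) - α • x k) - f (x k))) :
    (1 - A * ((2 * α * (β - l) - (L ^ 2 + l ^ 2)) / α) + B ^ 2 * (α * (β - l)) < 1) ∧
    (∀ k, ‖x (k + 1) - xs‖ ^ 2 ≤
      (1 - A * ((2 * α * (β - l) - (L ^ 2 + l ^ 2)) / α) + B ^ 2 * (α * (β - l)))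
        * ‖x k - xs‖ ^ 2) ∧
    Filter.Tendsto x Filter.atTop (nhds xs) := by
  have hd : 0 < β - l := sub_pos.2 hβl
  have hM : 0 ≤ L ^ 2 + l ^ 2 := by positivity
  have hα0 : 0 < α := lt_of_le_of_lt (by positivity) hα
  have hAB : B ^ 2 * (α * (β - l)) < A * ((2 * α * (β - l) - (L ^ 2 + l ^ 2)) / α) := by
    rw [div_lt_div_iff₀ hA (by positivity)] at hstep
    rw [← mul_div_assoc, lt_div_iff₀ hα0]
    linarith
  have hr : 1 - A * ((2 * α * (β - l) - (L ^ 2 + l ^ 2)) / α) + B ^ 2 * (α * (β - l)) < 1 := by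
    linarith
  have hcontr : ∀ k, ‖x (k + 1) - xs‖ ^ 2 ≤
      (1 - A * ((2 * α * (β - l) - (L ^ 2 + l ^ 2)) / α) + B ^ 2 * (α * (β - l)))
        * ‖x k - xs‖ ^ 2 := by
    intro k
    obtain ⟨hPmem, hPvar⟩ := hP (x k) (f (x k) - α • x k)
    obtain ⟨hsmem, hsvar⟩ := hxs
    rw [hΦ] at hPmem hsmem
    simp only [hΦ] at hPvar hsvar
    rw [hrec k, add_sub_right_comm]
    have hf := hLip (x k) xs
    have hs := hsLip (x k) xs
    refine norm_add_smul_sq_le (h := (f (x k) - f xs) - (s (x k) - s xs)) hα0 hd hM hA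
      (hlam k).1 (hlam k).2 hAB ?_ ?_
      (inner_smul_add_displacement_nonpos hα0 hPmem hPvar hsmem hsvar)
    · have h1 := real_inner_le_norm (s (x k) - s xs) (x k - xs)
      have h2 := mul_le_mul_of_nonneg_right hs (norm_nonneg (x k - xs))
      have h3 := hmono (x k) xs
      rw [inner_sub_left]
      linarith
    · have h1 := pow_le_pow_left₀ (norm_nonneg _) hf 2
      have h2 := pow_le_pow_left₀ (norm_nonneg _) hs 2
      have h3 := parallelogram_law_with_norm ℝ (f (x k) - f xs) (s (x k) - s xs)
      have h4 := mul_self_nonneg ‖(f (x k) - f xs) + (s (x k) - s xs)‖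
      nlinarith
  exact ⟨hr, hcontr, tendsto_of_norm_sub_sq_le_mul hr hcontr⟩
end

section
/- Let Ω ⊆ ℝ^n be nonempty, closed and convex, let f : ℝ^n → ℝ^n be L-Lipschitz continuous and β-strongly monotone, and let α > L²/β. Suppose x* solves the inverse variational inequality (f(x*) ∈ Ω and ⟨x*, y − f(x*)⟩ ≥ 0 for all y ∈ Ω). Then the sequence defined from any x₀ ∈ ℝ^n by x_{n+1} = x_n + (1/α)(P_Ω(f(x_n) − αx_n) − f(x_n)) satisfies ‖x_{n+1} − x*‖ ≤ √(1 − (αβ − L²)/α²) · ‖x_n − x*‖ for every n; in particular x_n converges to x* linearly. -/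
open scoped RealInnerProductSpace

/-- If `p` and `q` are the projections of `a` and `b` onto a convex set, then
`‖(a - p) - (b - q)‖ ≤ ‖a - b‖`: the complement of a projection is nonexpansive. Only the
variational inequalities of `p` and `q` tested against each other are needed. -/
theorem norm_sub_sq_le_of_variational {E : Type*} [NormedAddCommGroup E] [InnerProductSpace ℝ E]
    {a b p q : E} (hp : ⟪a - p, q - p⟫ ≤ 0) (hq : ⟪b - q, p - q⟫ ≤ 0) :
    ‖(p - q) - (a - b)‖ ^ 2 ≤ ‖a - b‖ ^ 2 := by
  have hfirm : ‖p - q‖ ^ 2 ≤ ⟪p - q, a - b⟫ := by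
    rw [← real_inner_self_eq_norm_sq]
    simp only [inner_sub_left, inner_sub_right] at hp hq ⊢
    linarith [real_inner_comm a p, real_inner_comm a q, real_inner_comm b p,
      real_inner_comm b q, real_inner_comm p q]
  rw [norm_sub_sq_real]
  linarith [sq_nonneg ‖p - q‖]

/-- A sequence whose distance to `a` contracts by a factor `r < 1` at each step tends to `a`. -/
theorem tendsto_of_norm_sub_le_mul {E : Type*} [SeminormedAddCommGroup E] {x : ℕ → E} {a : E}
    {r : ℝ} (hr₀ : 0 ≤ r) (hr₁ : r < 1) (h : ∀ k, ‖x (k + 1) - a‖ ≤ r * ‖x k - a‖) :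
    Filter.Tendsto x Filter.atTop (nhds a) := by
  have hgeom (k : ℕ) : ‖x k - a‖ ≤ r ^ k * ‖x 0 - a‖ := by
    induction k with
    | zero => simp
    | succ k ih =>
      calc ‖x (k + 1) - a‖ ≤ r * ‖x k - a‖ := h k
        _ ≤ r * (r ^ k * ‖x 0 - a‖) := by gcongr
        _ = r ^ (k + 1) * ‖x 0 - a‖ := by ring
  rw [tendsto_iff_norm_sub_tendsto_zero]
  refine squeeze_zero (fun _ ↦ norm_nonneg _) hgeom ?_
  simpa using (tendsto_pow_atTop_nhds_zero_of_lt_one hr₀ hr₁).mul_const ‖x 0 - a‖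

/-- He et al.'s scheme for the inverse variational inequality.
With Ω nonempty closed convex, f L-Lipschitz and β-strongly monotone,
α > L²/β, and x* a solution of the inverse variational inequality
(f(x*) ∈ Ω and ⟨x*, y − f(x*)⟩ ≥ 0 for all y ∈ Ω), the sequence
x_{k+1} = x_k + (1/α)(P_Ω(f(x_k) − αx_k) − f(x_k)) (from any x₀) satisfies
‖x_{k+1} − x*‖ ≤ √(1 − (αβ − L²)/α²)·‖x_k − x*‖ for every k; in particular
x_k → x* (linearly). -/
theorem stmt_19 {n : ℕ} (Ω : Set (EuclideanSpace ℝ (Fin n)))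
    (hΩne : Ω.Nonempty) (hΩcl : IsClosed Ω) (hΩconv : Convex ℝ Ω)
    (P : EuclideanSpace ℝ (Fin n) → EuclideanSpace ℝ (Fin n))
    (hP : ∀ z, P z ∈ Ω ∧ ∀ y ∈ Ω, ⟪z - P z, y - P z⟫ ≤ 0)
    (f : EuclideanSpace ℝ (Fin n) → EuclideanSpace ℝ (Fin n))
    (L β α : ℝ)
    (hLip : ∀ x y, ‖f x - f y‖ ≤ L * ‖x - y‖)
    (hβ : 0 < β)
    (hmono : ∀ x y, β * ‖x - y‖ ^ 2 ≤ ⟪f x - f y, x - y⟫)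
    (hα : L ^ 2 / β < α)
    (xs : EuclideanSpace ℝ (Fin n))
    (hxs : f xs ∈ Ω ∧ ∀ y ∈ Ω, 0 ≤ ⟪xs, y - f xs⟫)
    (x : ℕ → EuclideanSpace ℝ (Fin n))
    (hrec : ∀ k, x (k + 1) = x k + (1 / α) • (P (f (x k) - α • x k) - f (x k))) :
    (∀ k, ‖x (k + 1) - xs‖ ≤
      Real.sqrt (1 - (α * β - L ^ 2) / α ^ 2) * ‖x k - xs‖) ∧
    Filter.Tendsto x Filter.atTop (nhds xs) := by
  have hα₀ : 0 < α := lt_of_le_of_lt (by positivity) hα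
  have hαβ : L ^ 2 < α * β := (div_lt_iff₀ hβ).1 hα
  have hstep (k : ℕ) : ‖x (k + 1) - xs‖ ≤
      Real.sqrt (1 - (α * β - L ^ 2) / α ^ 2) * ‖x k - xs‖ := by
    obtain ⟨hpΩ, hp⟩ := hP (f (x k) - α • x k)
    have heq : α • (x (k + 1) - xs) = (P (f (x k) - α • x k) - f xs) -
        ((f (x k) - α • x k) - (f xs - α • xs)) := by
      rw [hrec k, smul_sub, smul_add, smul_smul, mul_one_div_cancel hα₀.ne', one_smul]
      abel
    have hq : ⟪(f xs - α • xs) - f xs, P (f (x k) - α • x k) - f xs⟫ ≤ 0 := by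
      rw [sub_sub_cancel_left, inner_neg_left, real_inner_smul_left]
      linarith [mul_nonneg hα₀.le (hxs.2 _ hpΩ)]
    have hcontr := norm_sub_sq_le_of_variational (hp _ hxs.1) hq
    rw [← heq, norm_smul, Real.norm_of_nonneg hα₀.le, mul_pow, sub_sub_sub_comm, ← smul_sub,
      norm_sub_sq_real (f (x k) - f xs), real_inner_smul_right, norm_smul, Real.norm_of_nonneg hα₀.le,
      mul_pow] at hcontr
    have hL : ‖f (x k) - f xs‖ ^ 2 ≤ L ^ 2 * ‖x k - xs‖ ^ 2 := by
      rw [← mul_pow]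
      exact pow_le_pow_left₀ (norm_nonneg _) (hLip _ _) 2
    have hm := mul_le_mul_of_nonneg_left (hmono (x k) xs) hα₀.le
    have hsq : 0 ≤ α * β * ‖x k - xs‖ ^ 2 := by positivity
    have hbound : ‖x (k + 1) - xs‖ ^ 2 ≤
        (1 - (α * β - L ^ 2) / α ^ 2) * ‖x k - xs‖ ^ 2 := by
      refine le_of_mul_le_mul_left ?_ (pow_pos hα₀ 2)
      have hexpand : α ^ 2 * ((1 - (α * β - L ^ 2) / α ^ 2) * ‖x k - xs‖ ^ 2) =
          (α ^ 2 - (α * β - L ^ 2)) * ‖x k - xs‖ ^ 2 := by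
        field_simp
      rw [hexpand]
      linarith
    rw [← Real.sqrt_sq (norm_nonneg (x k - xs)), ← Real.sqrt_mul' _ (sq_nonneg _)]
    exact Real.le_sqrt_of_sq_le hbound
  refine ⟨hstep, tendsto_of_norm_sub_le_mul (Real.sqrt_nonneg _) ?_ hstep⟩
  rw [Real.sqrt_lt' one_pos, one_pow]
  exact sub_lt_self _ (div_pos (sub_pos.2 hαβ) (pow_pos hα₀ 2))
end
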